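/- For every integer k ≥ 2 with k ≠ 3, the Markov spectrum of continued fractions with partial quotients bounded by k is an initial segment of the classical Markov spectrum: M(k) = M ∩ (−∞, √(k²+4k)]. -/

import Mathlib

open Filter Set
open scoped Pointwise

noncomputable section

/-- The `n`-th convergent of the continued fraction `[0; a 0, a 1, a 2, …]`. -/
def cfConv : ℕ → (ℕ → ℕ) → ℝ
  | 0, _ => 0
  | n + 1, a => 1 / (a 0 + cfConv n fun i => a (i + 1))

/-- The value `[0; a 0, a 1, a 2, …]` of the infinite continued fraction with
partial quotients `a 0, a 1, …` (the limit of its convergents). -/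
def cfVal (a : ℕ → ℕ) : ℝ := limUnder atTop fun n => cfConv n a

/-- The sequence of partial quotients obtained by concatenating the finite word `b`
with the sequence `θ`. -/
def app (b : List ℕ) (θ : ℕ → ℕ) : ℕ → ℕ := fun n =>
  if h : n < b.length then b.get ⟨n, h⟩ else θ (n - b.length)

/-- `λ_i(θ) = [a_i; a_{i+1}, …] + [0; a_{i-1}, a_{i-2}, …]` for a bi-infinite
sequence `θ` of partial quotients. -/
def lamCF (θ : ℤ → ℕ) (i : ℤ) : ℝ :=
  (θ i : ℝ) + cfVal (fun n => θ (i + 1 + n)) + cfVal (fun n => θ (i - 1 - n))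

/-- The classical Lagrange spectrum. -/
def LSpec : Set ℝ :=
  {x | ∃ θ : ℤ → ℕ, (∀ i, 1 ≤ θ i) ∧
    IsBoundedUnder (· ≤ ·) atTop (lamCF θ) ∧ x = limsup (lamCF θ) atTop}

/-- The classical Markov spectrum. -/
def MSpec : Set ℝ :=
  {x | ∃ θ : ℤ → ℕ, (∀ i, 1 ≤ θ i) ∧
    BddAbove (Set.range (lamCF θ)) ∧ x = ⨆ i, lamCF θ i}

/-- The Lagrange spectrum `L(k)` of sequences with partial quotients in `{1, …, k}`. -/
def LSpecK (k : ℕ) : Set ℝ :=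
  {x | ∃ θ : ℤ → ℕ, (∀ i, 1 ≤ θ i ∧ θ i ≤ k) ∧ x = limsup (lamCF θ) atTop}

/-- The Markov spectrum `M(k)` of sequences with partial quotients in `{1, …, k}`. -/
def MSpecK (k : ℕ) : Set ℝ :=
  {x | ∃ θ : ℤ → ℕ, (∀ i, 1 ≤ θ i ∧ θ i ≤ k) ∧ x = ⨆ i, lamCF θ i}

/-! ### Convergence and elementary properties of continued fractions -/

lemma two_step_sub {p q x y : ℝ} (hp : 1 ≤ p) (hq : 1 ≤ q) (hx : 0 ≤ x) (hy : 0 ≤ y) :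
    1 / (p + 1 / (q + x)) - 1 / (p + 1 / (q + y)) =
      (x - y) / ((p * (q + x) + 1) * (p * (q + y) + 1)) := by
  have h1 : 0 < q + x := by linarith
  have h2 : 0 < q + y := by linarith
  have h3 : 0 < p * (q + x) + 1 := by positivity
  have h4 : 0 < p * (q + y) + 1 := by positivity
  have e1 : 1 / (p + 1 / (q + x)) = (q + x) / (p * (q + x) + 1) := by field_simp
  have e2 : 1 / (p + 1 / (q + y)) = (q + y) / (p * (q + y) + 1) := by field_simp
  rw [e1, e2, div_sub_div _ _ h3.ne' h4.ne']
  congr 1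
  ring

lemma two_step_abs {p q x y : ℝ} (hp : 1 ≤ p) (hq : 1 ≤ q) (hx : 0 ≤ x) (hy : 0 ≤ y) :
    |1 / (p + 1 / (q + x)) - 1 / (p + 1 / (q + y))| ≤ |x - y| / 4 := by
  have h3 : 2 ≤ p * (q + x) + 1 := by nlinarith
  have h4 : 2 ≤ p * (q + y) + 1 := by nlinarith
  rw [two_step_sub hp hq hx hy, abs_div,
    abs_of_pos (show 0 < (p * (q + x) + 1) * (p * (q + y) + 1) by nlinarith)]
  apply div_le_div_of_nonneg_left (abs_nonneg _) (by norm_num)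
  nlinarith

lemma one_le_cast {a : ℕ} (h : 1 ≤ a) : (1 : ℝ) ≤ a := by exact_mod_cast h

lemma cfConv_mem (n : ℕ) : ∀ a : ℕ → ℕ, (∀ i, 1 ≤ a i) → 0 ≤ cfConv n a ∧ cfConv n a ≤ 1 := by
  induction n with
  | zero => intro a _; simp [cfConv]
  | succ n ih =>
    intro a ha
    obtain ⟨h0, -⟩ := ih (fun i => a (i + 1)) (fun i => ha _)
    have h1 := one_le_cast (ha 0)
    refine ⟨by simp only [cfConv]; positivity, ?_⟩
    simp only [cfConv]
    rw [div_le_one (by linarith)]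
    linarith

lemma cfConv_contract (n m j : ℕ) : ∀ a : ℕ → ℕ, (∀ i, 1 ≤ a i) →
    |cfConv (2 * j + n) a - cfConv (2 * j + m) a| ≤ (1 / 4) ^ j := by
  induction j with
  | zero =>
    intro a ha
    have h1 := cfConv_mem (2 * 0 + n) a ha
    have h2 := cfConv_mem (2 * 0 + m) a ha
    rw [pow_zero, abs_le]
    constructor <;> linarith [h1.1, h1.2, h2.1, h2.2]
  | succ j ih =>
    intro a ha
    have e1 : 2 * (j + 1) + n = (2 * j + n) + 1 + 1 := by ring
    have e2 : 2 * (j + 1) + m = (2 * j + m) + 1 + 1 := by ring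
    rw [e1, e2]
    simp only [cfConv]
    have hb : ∀ i, 1 ≤ (fun i => a (i + 1 + 1)) i := fun i => ha _
    refine (two_step_abs (one_le_cast (ha 0)) (one_le_cast (ha _)) (cfConv_mem _ _ hb).1
      (cfConv_mem _ _ hb).1).trans ?_
    have := ih _ hb
    rw [pow_succ]
    linarith

lemma cfConv_tendsto {a : ℕ → ℕ} (ha : ∀ i, 1 ≤ a i) :
    Tendsto (fun n => cfConv n a) atTop (nhds (cfVal a)) := by
  apply CauchySeq.tendsto_limUnder
  rw [Metric.cauchySeq_iff]
  intro ε hε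
  obtain ⟨j, hj⟩ := exists_pow_lt_of_lt_one hε (show (1 / 4 : ℝ) < 1 by norm_num)
  refine ⟨2 * j, fun m hm n hn => ?_⟩
  obtain ⟨m', rfl⟩ := Nat.exists_eq_add_of_le hm
  obtain ⟨n', rfl⟩ := Nat.exists_eq_add_of_le hn
  exact (cfConv_contract m' n' j a ha).trans_lt hj

lemma cfVal_nonneg {a : ℕ → ℕ} (ha : ∀ i, 1 ≤ a i) : 0 ≤ cfVal a :=
  ge_of_tendsto' (cfConv_tendsto ha) fun n => (cfConv_mem n a ha).1

lemma cfVal_le_one {a : ℕ → ℕ} (ha : ∀ i, 1 ≤ a i) : cfVal a ≤ 1 :=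
  le_of_tendsto' (cfConv_tendsto ha) fun n => (cfConv_mem n a ha).2

lemma cfVal_eq {a : ℕ → ℕ} (ha : ∀ i, 1 ≤ a i) :
    cfVal a = 1 / (a 0 + cfVal fun i => a (i + 1)) := by
  have hb : ∀ i, 1 ≤ (fun i => a (i + 1)) i := fun i => ha _
  have h1 := (tendsto_add_atTop_iff_nat 1).2 (cfConv_tendsto ha)
  have h2 : Tendsto (fun n => cfConv (n + 1) a) atTop
      (nhds (1 / (a 0 + cfVal fun i => a (i + 1)))) := by
    simp only [cfConv]
    apply Tendsto.div tendsto_const_nhds (tendsto_const_nhds.add (cfConv_tendsto hb))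
    have := cfVal_nonneg hb
    have := one_le_cast (ha 0)
    linarith
  exact tendsto_nhds_unique h1 h2

lemma cfVal_le_inv {a : ℕ → ℕ} (ha : ∀ i, 1 ≤ a i) : cfVal a ≤ 1 / a 0 := by
  rw [cfVal_eq ha]
  have := cfVal_nonneg (a := fun i => a (i + 1)) fun i => ha _
  have := one_le_cast (ha 0)
  exact one_div_le_one_div_of_le (by linarith) (by linarith)

lemma inv_le_cfVal {a : ℕ → ℕ} (ha : ∀ i, 1 ≤ a i) : 1 / ((a 0 : ℝ) + 1) ≤ cfVal a := by
  rw [cfVal_eq ha]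
  have := cfVal_nonneg (a := fun i => a (i + 1)) fun i => ha _
  have := cfVal_le_one (a := fun i => a (i + 1)) fun i => ha _
  have := one_le_cast (ha 0)
  exact one_div_le_one_div_of_le (by linarith) (by linarith)

lemma cfVal_agree (j : ℕ) : ∀ a b : ℕ → ℕ, (∀ i, 1 ≤ a i) → (∀ i, 1 ≤ b i) →
    (∀ i < 2 * j, a i = b i) → |cfVal a - cfVal b| ≤ (1 / 4) ^ j := by
  induction j with
  | zero =>
    intro a b ha hb _
    rw [pow_zero, abs_le]
    constructor <;> linarith [cfVal_nonneg ha, cfVal_nonneg hb, cfVal_le_one ha, cfVal_le_one hb]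
  | succ j ih =>
    intro a b ha hb hab
    have ha1 : ∀ i, 1 ≤ (fun i => a (i + 1)) i := fun i => ha _
    have hb1 : ∀ i, 1 ≤ (fun i => b (i + 1)) i := fun i => hb _
    have ha2 : ∀ i, 1 ≤ (fun i => a (i + 1 + 1)) i := fun i => ha _
    have hb2 : ∀ i, 1 ≤ (fun i => b (i + 1 + 1)) i := fun i => hb _
    rw [cfVal_eq ha, cfVal_eq hb, cfVal_eq ha1, cfVal_eq hb1, ← hab 0 (by omega),
      ← hab (0 + 1) (by omega)]
    refine (two_step_abs (one_le_cast (ha 0)) (one_le_cast (ha _)) (cfVal_nonneg ha2)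
      (cfVal_nonneg hb2)).trans ?_
    have := ih _ _ ha2 hb2 fun i hi => hab _ (by omega)
    rw [pow_succ]
    linarith

/-- The sequence with first term `a` followed by `t`. -/
def consSeq (a : ℕ) (t : ℕ → ℕ) : ℕ → ℕ
  | 0 => a
  | n + 1 => t n

lemma consSeq_pos {a : ℕ} {t : ℕ → ℕ} (ha : 1 ≤ a) (ht : ∀ i, 1 ≤ t i) (i : ℕ) :
    1 ≤ consSeq a t i := by
  cases i with
  | zero => exact ha
  | succ n => exact ht n

lemma cfVal_consSeq {a : ℕ} {t : ℕ → ℕ} (ha : 1 ≤ a) (ht : ∀ i, 1 ≤ t i) :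
    cfVal (consSeq a t) = 1 / (a + cfVal t) :=
  cfVal_eq (consSeq_pos ha ht)

/-! ### The map `z ↦ [0; 1, k + z]` -/

/-- The map `z ↦ [0; 1, κ + z]`. -/
def stepMap (κ z : ℝ) : ℝ := 1 / (1 + 1 / (κ + z))

lemma stepMap_sub {κ x y : ℝ} (hκ : 1 ≤ κ) (hx : 0 ≤ x) (hy : 0 ≤ y) :
    stepMap κ x - stepMap κ y = (x - y) / ((κ + x + 1) * (κ + y + 1)) := by
  rw [stepMap, stepMap, two_step_sub le_rfl hκ hx hy]
  simp

lemma stepMap_nonneg {κ z : ℝ} (hκ : 1 ≤ κ) (hz : 0 ≤ z) : 0 ≤ stepMap κ z := by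
  unfold stepMap
  positivity

lemma stepMap_eq {κ z : ℝ} (hκ : 1 ≤ κ) (hz : 0 ≤ z) :
    stepMap κ z = (κ + z) / (κ + z + 1) := by
  unfold stepMap
  have : 0 < κ + z := by linarith
  field_simp

lemma le_stepMap {κ z : ℝ} (hκ : 1 ≤ κ) (hz : 0 ≤ z) : κ / (κ + 1) ≤ stepMap κ z := by
  rw [stepMap_eq hκ hz, div_le_div_iff₀ (by linarith) (by linarith)]
  nlinarith

lemma stepMap_le_iff {κ x y : ℝ} (hκ : 1 ≤ κ) (hx : 0 ≤ x) (hy : 0 ≤ y) :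
    stepMap κ x ≤ stepMap κ y ↔ x ≤ y := by
  have h := stepMap_sub hκ hx hy
  have hp : 0 < (κ + x + 1) * (κ + y + 1) := by positivity
  rw [← sub_nonpos, h, ← sub_nonpos (a := x), div_nonpos_iff]
  constructor
  · rintro (⟨-, h2⟩ | ⟨h1, -⟩)
    · linarith
    · exact h1
  · intro h1
    exact Or.inr ⟨h1, hp.le⟩

lemma stepMap_iter_nonneg {κ z : ℝ} (hκ : 1 ≤ κ) (hz : 0 ≤ z) (n : ℕ) :
    0 ≤ (stepMap κ)^[n] z := by
  induction n with
  | zero => exact hz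
  | succ n ih => rw [Function.iterate_succ_apply']; exact stepMap_nonneg hκ ih

lemma stepMap_iter_le_iff {κ x y : ℝ} (hκ : 1 ≤ κ) (hx : 0 ≤ x) (hy : 0 ≤ y) (n : ℕ) :
    (stepMap κ)^[n] x ≤ (stepMap κ)^[n] y ↔ x ≤ y := by
  induction n with
  | zero => rfl
  | succ n ih =>
    rw [Function.iterate_succ_apply', Function.iterate_succ_apply',
      stepMap_le_iff hκ (stepMap_iter_nonneg hκ hx n) (stepMap_iter_nonneg hκ hy n), ih]

lemma stepMap_sub_le {κ x y : ℝ} (hκ : 1 ≤ κ) (hx : 0 ≤ x) (hxy : x ≤ y) :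
    stepMap κ y - stepMap κ x ≤ (y - x) / 4 := by
  rw [stepMap_sub hκ (hx.trans hxy) hx]
  apply div_le_div_of_nonneg_left (by linarith) (by norm_num)
  nlinarith

lemma stepMap_iter_sub_le {κ x y : ℝ} (hκ : 1 ≤ κ) (hx : 0 ≤ x) (hxy : x ≤ y) (n : ℕ) :
    (stepMap κ)^[n] y - (stepMap κ)^[n] x ≤ (y - x) * (1 / 4) ^ n := by
  induction n with
  | zero => simp
  | succ n ih =>
    rw [Function.iterate_succ_apply', Function.iterate_succ_apply']
    refine (stepMap_sub_le hκ (stepMap_iter_nonneg hκ hx n)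
      ((stepMap_iter_le_iff hκ hx (hx.trans hxy) n).2 hxy)).trans ?_
    rw [pow_succ]
    linarith

lemma le_stepMap_iter {κ z : ℝ} (hκ : 1 ≤ κ) (hz : 0 ≤ z) (h : z ≤ stepMap κ z) (n : ℕ) :
    z ≤ (stepMap κ)^[n] z := by
  induction n with
  | zero => exact le_rfl
  | succ n ih =>
    rw [Function.iterate_succ_apply']
    exact h.trans ((stepMap_le_iff hκ hz (stepMap_iter_nonneg hκ hz n)).2 ih)

/-- Moving the centre of a doubly infinite word `… 1 κ 1 κ …` away from the balanced position
does not increase the sum of the two continued fractions. -/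
lemma shift_sum_le {κ γ b : ℝ} (hκ : 1 ≤ κ) (hγ : 0 ≤ γ) (hb : 0 ≤ b) (h : γ ≤ stepMap κ γ)
    (j m : ℕ) (hab : (stepMap κ)^[m + (j + 1)] γ ≤ stepMap κ b) :
    (stepMap κ)^[j + 1] b + (stepMap κ)^[m] γ ≤ (stepMap κ)^[m + (j + 1)] γ + b := by
  have ha0 := stepMap_iter_nonneg hκ hγ m
  set a := (stepMap κ)^[m] γ with ha
  have e : (stepMap κ)^[m + (j + 1)] γ = (stepMap κ)^[j + 1] a := by
    rw [ha, ← Function.iterate_add_apply, add_comm]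
  have haφ : a ≤ stepMap κ a := by
    have := (stepMap_iter_le_iff hκ hγ (stepMap_nonneg hκ hγ) m).2 h
    rwa [← Function.iterate_succ_apply, Function.iterate_succ_apply'] at this
  rw [e] at hab ⊢
  have hab' : a ≤ b := by
    refine (le_stepMap_iter hκ ha0 haφ j).trans ?_
    rwa [Function.iterate_succ_apply', stepMap_le_iff hκ (stepMap_iter_nonneg hκ ha0 j) hb] at hab
  have h1 := stepMap_iter_sub_le hκ ha0 hab' (j + 1)
  have h2 : ((1 : ℝ) / 4) ^ (j + 1) ≤ 1 := pow_le_one₀ (by norm_num) (by norm_num)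
  nlinarith [mul_nonneg (sub_nonneg.2 hab') (sub_nonneg.2 h2)]

/-! ### Sums of Cantor sets given by splitting intervals -/

/-- Every interval `[l, h]` (with distinguished gap length `g`) of the family `P` contains two
members of `P` at its ends, separated by a gap of length `g` which is at most the length of each of
them, with smaller gaps in turn. -/
def SplitFamily (c : ℝ) (P : ℝ → ℝ → ℝ → Prop) : Prop :=
  ∀ l h g, P l h g → 0 ≤ g ∧ c * (h - l) ≤ g ∧ ∃ x y g₁ g₂, P l x g₁ ∧ P y h g₂ ∧
    y - x = g ∧ g ≤ x - l ∧ g ≤ h - y ∧ g₁ ≤ g ∧ g₂ ≤ g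

lemma SplitFamily.exists_small {c : ℝ} (hc1 : c ≤ 1) {P R : ℝ → ℝ → ℝ → Prop}
    (hP : SplitFamily c P) (hR : SplitFamily c R) {s l h g l' h' g' : ℝ}
    (h1 : P l h g) (h2 : R l' h' g') (hl : l + l' ≤ s) (hh : s ≤ h + h')
    (hg : g ≤ h' - l') (hg' : g' ≤ h - l) (N : ℕ) :
    ∃ l₁ h₁ g₁ l₂ h₂ g₂, P l₁ h₁ g₁ ∧ R l₂ h₂ g₂ ∧ l₁ + l₂ ≤ s ∧ s ≤ h₁ + h₂ ∧
      g₁ ≤ h₂ - l₂ ∧ g₂ ≤ h₁ - l₁ ∧ l ≤ l₁ ∧ l' ≤ l₂ ∧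
      (h₁ - l₁) + (h₂ - l₂) ≤ (1 - c) ^ N * ((h - l) + (h' - l')) := by
  induction N with
  | zero => exact ⟨l, h, g, l', h', g', h1, h2, hl, hh, hg, hg', le_rfl, le_rfl, by simp⟩
  | succ N ih =>
    obtain ⟨l₁, h₁, g₁, l₂, h₂, g₂, k1, k2, k3, k4, k5, k6, k8, k9, k7⟩ := ih
    obtain ⟨c0, c1, x, y, a, b, p1, p2, p3, p4, p5, p6, p7⟩ := hP _ _ _ k1
    obtain ⟨c0', c2, x', y', a', b', q1, q2, q3, q4, q5, q6, q7⟩ := hR _ _ _ k2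
    have key : ∀ S : ℝ, S ≤ (1 - c) * ((h₁ - l₁) + (h₂ - l₂)) →
        S ≤ (1 - c) ^ (N + 1) * ((h - l) + (h' - l')) := by
      intro S hS
      rw [pow_succ', mul_assoc]
      exact hS.trans (mul_le_mul_of_nonneg_left k7 (by linarith))
    rcases le_total g₂ g₁ with hle | hle
    · by_cases hs : s ≤ x + h₂
      · exact ⟨l₁, x, a, l₂, h₂, g₂, p1, k2, k3, hs, by linarith,
          by linarith, by linarith, by linarith, key _ (by linarith)⟩
      · exact ⟨y, h₁, b, l₂, h₂, g₂, p2, k2, by linarith, k4, by linarith,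
          by linarith, by linarith, by linarith, key _ (by linarith)⟩
    · by_cases hs : s ≤ h₁ + x'
      · exact ⟨l₁, h₁, g₁, l₂, x', a', k1, q1, k3, hs, by linarith,
          by linarith, by linarith, by linarith, key _ (by linarith)⟩
      · exact ⟨l₁, h₁, g₁, y', h₂, b', k1, q2, by linarith, k4, by linarith,
          by linarith, by linarith, by linarith, key _ (by linarith)⟩

/-! ### Möbius maps -/

/-- `f` is a Möbius map with determinant sign `σ`, whose denominator is proportional to
`1 + r z`. -/
structure IsMoebius (f : ℝ → ℝ) (Q r σ : ℝ) : Prop where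
  pos : 0 < Q
  nonneg : 0 ≤ r
  le_one : r ≤ 1
  sign : σ = 1 ∨ σ = -1
  sub : ∀ z z' : ℝ, 0 ≤ z → 0 ≤ z' →
    f z - f z' = σ * (z - z') / (Q * ((1 + r * z) * (1 + r * z')))

lemma IsMoebius.sub_inv {f : ℝ → ℝ} {Q r σ : ℝ} (hf : IsMoebius f Q r σ) {t t' : ℝ}
    (ht : 0 < t) (ht' : 0 < t') :
    f (1 / t) - f (1 / t') = σ * (t' - t) / (Q * ((t + r) * (t' + r))) := by
  rw [hf.sub _ _ (by positivity) (by positivity)]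
  have := hf.pos
  have := hf.nonneg
  have h1 : 0 < t + r := by linarith
  have h2 : 0 < t' + r := by linarith
  field_simp

lemma IsMoebius.comp_inv {f : ℝ → ℝ} {Q r σ a : ℝ} (hf : IsMoebius f Q r σ) (ha : 1 ≤ a) :
    IsMoebius (fun z => f (1 / (a + z))) (Q * (a + r) ^ 2) (1 / (a + r)) (-σ) := by
  have hQ := hf.pos
  have hr := hf.nonneg
  have h1 : 0 < a + r := by linarith
  refine ⟨by positivity, by positivity, ?_, ?_, ?_⟩
  · rw [div_le_one h1]
    linarith
  · rcases hf.sign with h | h <;> simp [h]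
  · intro z z' hz hz'
    have h2 : 0 < a + z + r := by linarith
    have h3 : 0 < a + z' + r := by linarith
    have h4 : 0 < a + r + z := by linarith
    have h5 : 0 < a + r + z' := by linarith
    rw [hf.sub_inv (by linarith) (by linarith)]
    have e1 : 1 + 1 / (a + r) * z = (a + z + r) / (a + r) := by field_simp; ring
    have e2 : 1 + 1 / (a + r) * z' = (a + z' + r) / (a + r) := by field_simp; ring
    rw [e1, e2]
    field_simp
    ring

lemma isMoebius_id : IsMoebius id 1 0 1 :=
  ⟨one_pos, le_rfl, zero_le_one, Or.inl rfl, fun z z' _ _ => by simp⟩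

lemma isMoebius_iterate {κ : ℝ} (hκ : 4 ≤ κ) (n : ℕ) :
    ∃ Q r, r ≤ 1 / 4 ∧ IsMoebius (stepMap κ)^[n] Q r 1 := by
  induction n with
  | zero => exact ⟨1, 0, by norm_num, isMoebius_id⟩
  | succ n ih =>
    obtain ⟨Q, r, hr, h⟩ := ih
    have h1 := (h.comp_inv le_rfl).comp_inv (a := κ) (by linarith)
    rw [neg_neg] at h1
    refine ⟨_, _, ?_, h1⟩
    have := h.nonneg
    have : 0 ≤ 1 / (1 + r) := by positivity
    exact one_div_le_one_div_of_le (by norm_num) (by linarith)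

/-! ### The restricted system of continued fractions -/

/-- The largest value `[0; 1, 3, 1, 3, …]` of the restricted system. -/
def hullSup : ℝ := (Real.sqrt 21 - 3) / 2

/-- The smallest value `[0; 4, 1, 3, 1, 3, …]` of the restricted system. -/
def hullInf : ℝ := 1 / (4 + hullSup)

lemma hullSup_sq : hullSup ^ 2 + 3 * hullSup = 3 := by
  have := Real.sq_sqrt (show (0 : ℝ) ≤ 21 by norm_num)
  unfold hullSup
  nlinarith

lemma lt_hullSup : 0.7912 < hullSup := by
  have : 4.5824 < Real.sqrt 21 := Real.lt_sqrt_of_sq_lt (by norm_num)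
  unfold hullSup
  linarith

lemma hullSup_lt : hullSup < 0.7914 := by
  have : Real.sqrt 21 < 4.5828 := (Real.sqrt_lt' (by norm_num)).2 (by norm_num)
  unfold hullSup
  linarith

lemma lt_hullInf : 0.2086 < hullInf := by
  have := lt_hullSup
  have := hullSup_lt
  unfold hullInf
  rw [lt_div_iff₀ (by linarith)]
  linarith

lemma hullInf_lt : hullInf < 0.2088 := by
  have := lt_hullSup
  unfold hullInf
  rw [div_lt_iff₀ (by linarith)]
  linarith

lemma hullSup_eq : 1 / (1 + 1 / (3 + hullSup)) = hullSup := by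
  have h := hullSup_sq
  have := lt_hullSup
  have : 0 < 3 + hullSup := by linarith
  have : 0 < 3 + hullSup + 1 := by linarith
  field_simp
  linarith

/-- The largest digit that may follow the reversed word `w`: at most `e` after the initial word
`1`, at most `3` after any later `1`, and at most `4` otherwise. -/
def maxDigit (e : ℕ) : List ℕ → ℕ
  | [] => 4
  | a :: w => if a = 1 then (if w = [] then e else 3) else 4

/-- The admissible reversed words. -/
def ValidWord (e : ℕ) : List ℕ → Prop
  | [] => True
  | a :: w => ValidWord e w ∧ 1 ≤ a ∧ a ≤ maxDigit e w

/-- The map `z ↦ f [0; a₁, …, aₙ + z]` where `a₁ … aₙ` is the reverse of the given word. -/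
def wordMap (f : ℝ → ℝ) : List ℕ → ℝ → ℝ
  | [], z => f z
  | a :: w, z => wordMap f w (1 / (a + z))

lemma two_le_maxDigit {e : ℕ} (he : 2 ≤ e) (w : List ℕ) : 2 ≤ maxDigit e w := by
  cases w with
  | nil => simp [maxDigit]
  | cons a w => simp only [maxDigit]; split_ifs <;> omega

lemma maxDigit_le {e K : ℕ} (he : e ≤ K) (hK : 4 ≤ K) (w : List ℕ) : maxDigit e w ≤ K := by
  cases w with
  | nil => simpa [maxDigit]
  | cons a w => simp only [maxDigit]; split_ifs <;> omega

lemma three_le_maxDigit {e : ℕ} {w : List ℕ} (hw : w ≠ [1]) : 3 ≤ maxDigit e w := by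
  cases w with
  | nil => simp [maxDigit]
  | cons a w =>
    simp only [maxDigit]
    split_ifs with h1 h2
    · simp [h1, h2] at hw
    all_goals omega

/-- The intervals of the restricted system: the hull of the values of continued fractions
beginning with a given word followed by a digit at least `d`; its gap separates the
continuations by `d` from those by larger digits. -/
def NodeInterval (f : ℝ → ℝ) (e : ℕ) (l h g : ℝ) : Prop :=
  ∃ (w : List ℕ) (d : ℕ) (Q r σ : ℝ), ValidWord e w ∧ 1 ≤ d ∧ d < maxDigit e w ∧
    IsMoebius (wordMap f w) Q r σ ∧ (w = [1] → 4 / 5 ≤ r) ∧ (w = [] → r ≤ 1 / 4) ∧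
    g = (1 + hullInf - hullSup) / (Q * ((d + hullSup + r) * (d + 1 + hullInf + r))) ∧
    ((σ = 1 ∧ l = wordMap f w (1 / (maxDigit e w + hullSup)) ∧
        h = wordMap f w (1 / (d + 1 / (maxDigit e (d :: w) + hullSup)))) ∨
      (σ = -1 ∧ h = wordMap f w (1 / (maxDigit e w + hullSup)) ∧
        l = wordMap f w (1 / (d + 1 / (maxDigit e (d :: w) + hullSup)))))

lemma gap_le_left {M d r Q : ℝ} (hQ : 0 < Q) (hd : 1 ≤ d) (hM : d + 1 ≤ M) (hr : 0 ≤ r)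
    (h : 2 ≤ d ∨ 3 ≤ M ∨ 4 / 5 ≤ r) :
    (1 + hullInf - hullSup) / (Q * ((d + hullSup + r) * (d + 1 + hullInf + r))) ≤
      (M + hullSup - (d + 1 + hullInf)) /
        (Q * ((d + 1 + hullInf + r) * (M + hullSup + r))) := by
  have h1 := lt_hullSup
  have h2 := hullSup_lt
  have h3 := lt_hullInf
  have h4 := hullInf_lt
  set X := hullSup
  set m := hullInf
  have p1 : 0 < d + X + r := by linarith
  have p2 : 0 < d + 1 + m + r := by linarith
  have p3 : 0 < M + X + r := by linarith
  have key : (1 + m - X) * (M + X + r) ≤ (M + X - (d + 1 + m)) * (d + X + r) := by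
    rcases h with h | h | h
    · nlinarith [mul_nonneg (sub_nonneg.2 hM) (show 0 ≤ d + X + r - (1 + m - X) by linarith),
        mul_nonneg (show 0 ≤ X - m - 0.5824 by linarith) p1.le,
        mul_nonneg (show 0 ≤ 0.4176 - (1 + m - X) by linarith) p1.le]
    · rcases le_or_gt 2 d with hd2 | hd2
      · nlinarith [mul_nonneg (sub_nonneg.2 hM) (show 0 ≤ d + X + r - (1 + m - X) by linarith),
          mul_nonneg (show 0 ≤ X - m - 0.5824 by linarith) p1.le,
          mul_nonneg (show 0 ≤ 0.4176 - (1 + m - X) by linarith) p1.le]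
      · nlinarith [mul_nonneg (show 0 ≤ M - 3 by linarith)
            (show 0 ≤ d + X + r - (1 + m - X) by linarith),
          mul_nonneg (show 0 ≤ X - m - 0.5824 by linarith) p1.le,
          mul_nonneg (show 0 ≤ 0.4176 - (1 + m - X) by linarith) p1.le,
          mul_nonneg (show 0 ≤ 2 - d by linarith) p1.le,
          mul_nonneg (show 0 ≤ 2 - d by linarith) (show 0 ≤ d - 1 by linarith),
          mul_nonneg (show 0 ≤ 2 - d by linarith) hr]
    · nlinarith [mul_nonneg (sub_nonneg.2 hM) (show 0 ≤ d + X + r - (1 + m - X) by linarith),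
        mul_nonneg (show 0 ≤ X - m - 0.5824 by linarith) p1.le,
        mul_nonneg (show 0 ≤ 0.4176 - (1 + m - X) by linarith) p1.le]
  rw [div_le_div_iff₀ (by positivity) (by positivity)]
  have := mul_le_mul_of_nonneg_left key (show 0 ≤ Q * (d + 1 + m + r) by positivity)
  nlinarith

lemma gap_le_right {μ d r Q : ℝ} (hQ : 0 < Q) (hd : 1 ≤ d) (hr : 0 ≤ r) (hμ : 0 ≤ μ)
    (hμ' : μ ≤ 0.36) :
    (1 + hullInf - hullSup) / (Q * ((d + hullSup + r) * (d + 1 + hullInf + r))) ≤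
      (hullSup - μ) / (Q * ((d + μ + r) * (d + hullSup + r))) := by
  have h1 := lt_hullSup
  have h2 := hullSup_lt
  have h3 := lt_hullInf
  have h4 := hullInf_lt
  set X := hullSup
  set m := hullInf
  have p1 : 0 < d + X + r := by linarith
  have p2 : 0 < d + μ + r := by linarith
  apply div_le_div₀ (by linarith) (by linarith) (by positivity)
  apply mul_le_mul_of_nonneg_left _ hQ.le
  rw [mul_comm]
  exact mul_le_mul_of_nonneg_left (by linarith) p1.le

lemma first_gap_le {a d r Q : ℝ} (hQ : 0 < Q) (hd : 1 ≤ d) (hr : 0 ≤ r) (ha : d ≤ a) :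
    (1 + hullInf - hullSup) / (Q * (a + r) ^ 2 *
      ((1 + hullSup + 1 / (a + r)) * (1 + 1 + hullInf + 1 / (a + r)))) ≤
    (1 + hullInf - hullSup) / (Q * ((d + hullSup + r) * (d + 1 + hullInf + r))) := by
  have h1 := lt_hullSup
  have h2 := hullSup_lt
  have h3 := lt_hullInf
  have h4 := hullInf_lt
  set X := hullSup
  set m := hullInf
  have p1 : 0 < d + X + r := by linarith
  have p2 : 0 < d + 1 + m + r := by linarith
  have p3 : 0 < a + r := by linarith
  have e : Q * (a + r) ^ 2 * ((1 + X + 1 / (a + r)) * (1 + 1 + m + 1 / (a + r))) =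
      Q * (((1 + X) * (a + r) + 1) * ((2 + m) * (a + r) + 1)) := by
    field_simp
    ring
  rw [e]
  apply div_le_div_of_nonneg_left (by linarith) (by positivity)
  apply mul_le_mul_of_nonneg_left _ hQ.le
  apply mul_le_mul _ _ p2.le (by nlinarith)
  · nlinarith
  · nlinarith

lemma next_gap_le {d r Q : ℝ} (hQ : 0 < Q) (hd : 1 ≤ d) (hr : 0 ≤ r) :
    (1 + hullInf - hullSup) / (Q * ((d + 1 + hullSup + r) * (d + 1 + 1 + hullInf + r))) ≤
    (1 + hullInf - hullSup) / (Q * ((d + hullSup + r) * (d + 1 + hullInf + r))) := by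
  have h1 := lt_hullSup
  have h2 := hullSup_lt
  have h3 := lt_hullInf
  have h4 := hullInf_lt
  set X := hullSup
  set m := hullInf
  have p1 : 0 < d + X + r := by linarith
  have p2 : 0 < d + 1 + m + r := by linarith
  apply div_le_div_of_nonneg_left (by linarith) (by positivity)
  apply mul_le_mul_of_nonneg_left _ hQ.le
  exact mul_le_mul (by linarith) (by linarith) p2.le (by linarith)

lemma nodeInterval_cons {f : ℝ → ℝ} {e : ℕ} {w : List ℕ} {Q r σ : ℝ} {a : ℕ}
    (he : 2 ≤ e) (hw : ValidWord e w) (hf : IsMoebius (wordMap f w) Q r σ)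
    (hr : w = [] → r ≤ 1 / 4) (ha : 1 ≤ a) (ha' : a ≤ maxDigit e w) :
    (σ = 1 → NodeInterval f e (wordMap f w (1 / (a + hullSup)))
      (wordMap f w (1 / (a + 1 / (maxDigit e (a :: w) + hullSup))))
      ((1 + hullInf - hullSup) / (Q * (a + r) ^ 2 *
        ((1 + hullSup + 1 / (a + r)) * (1 + 1 + hullInf + 1 / (a + r)))))) ∧
    (σ = -1 → NodeInterval f e (wordMap f w (1 / (a + 1 / (maxDigit e (a :: w) + hullSup))))
      (wordMap f w (1 / (a + hullSup)))
      ((1 + hullInf - hullSup) / (Q * (a + r) ^ 2 *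
        ((1 + hullSup + 1 / (a + r)) * (1 + 1 + hullInf + 1 / (a + r)))))) := by
  have ha1 := one_le_cast ha
  have h1 : IsMoebius (wordMap f (a :: w)) (Q * (a + r) ^ 2) (1 / (a + r)) (-σ) :=
    hf.comp_inv ha1
  have hv : ValidWord e (a :: w) := ⟨hw, ha, ha'⟩
  have h45 : a :: w = [1] → 4 / 5 ≤ 1 / ((a : ℝ) + r) := by
    intro h
    simp only [List.cons.injEq] at h
    have hr4 := hr h.2
    have := hf.nonneg
    rw [h.1, Nat.cast_one, le_div_iff₀ (by linarith)]
    linarith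
  have hM : 1 < maxDigit e (a :: w) := two_le_maxDigit he _
  have htop : wordMap f w (1 / (a + hullSup)) = wordMap f (a :: w)
      (1 / (((1 : ℕ) : ℝ) + 1 / (maxDigit e (1 :: a :: w) + hullSup))) := by
    simp only [maxDigit, if_true, wordMap, Nat.cast_one, reduceCtorEq, if_false, Nat.cast_ofNat,
      hullSup_eq]
  constructor
  · intro hσ
    refine ⟨a :: w, 1, _, _, _, hv, le_rfl, hM, h1, h45, by simp, by simp, Or.inr ?_⟩
    exact ⟨by rw [hσ], rfl, htop⟩
  · intro hσ
    refine ⟨a :: w, 1, _, _, _, hv, le_rfl, hM, h1, h45, by simp, by simp, Or.inl ?_⟩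
    exact ⟨by rw [hσ, neg_neg], rfl, htop⟩

/-- A lower bound for the proportion of a node interval occupied by its gap, when digits are
bounded by `K`. -/
def gapRatio (K : ℕ) : ℝ := 1 / (4 * ((K : ℝ) + 2) ^ 2)

lemma gapRatio_pos (K : ℕ) : 0 < gapRatio K := by unfold gapRatio; positivity

lemma gapRatio_le_one (K : ℕ) : gapRatio K ≤ 1 := by
  unfold gapRatio
  rw [div_le_one (by positivity)]
  have : (0 : ℝ) ≤ K := Nat.cast_nonneg K
  nlinarith

lemma gapRatio_div_le {K d : ℕ} {Q r : ℝ} (hQ : 0 < Q) (hr : 0 ≤ r) (hr1 : r ≤ 1)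
    (hd : d + 1 ≤ K) : gapRatio K * (1 / Q) ≤
      (1 + hullInf - hullSup) / (Q * ((d + hullSup + r) * (d + 1 + hullInf + r))) := by
  have h1 := lt_hullSup
  have h2 := hullSup_lt
  have h3 := lt_hullInf
  have h4 := hullInf_lt
  have hd' : (d : ℝ) + 1 ≤ K := by exact_mod_cast hd
  have hd0 : (0 : ℝ) ≤ d := Nat.cast_nonneg d
  unfold gapRatio
  rw [div_mul_div_comm]
  have p : (d + hullSup + r) * (d + 1 + hullInf + r) ≤ ((K : ℝ) + 2) ^ 2 := by
    rw [sq]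
    exact mul_le_mul (by linarith) (by linarith) (by linarith) (by linarith)
  have p0 : 0 < d + hullSup + r := by linarith
  have p1 : 0 < d + 1 + hullInf + r := by linarith
  have p2 : (0 : ℝ) ≤ ((K : ℝ) + 2) ^ 2 := by positivity
  rw [div_le_div_iff₀ (by positivity) (by positivity)]
  have := mul_le_mul_of_nonneg_left p hQ.le
  nlinarith [mul_nonneg (mul_nonneg p2 hQ.le)
    (show 0 ≤ 4 * (1 + hullInf - hullSup) - 1 by linarith)]

lemma splitFamily_nodeInterval (f : ℝ → ℝ) {e K : ℕ} (he : 2 ≤ e) (heK : e ≤ K) (hK : 4 ≤ K) :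
    SplitFamily (gapRatio K) (NodeInterval f e) := by
  rintro l h g ⟨w, d, Q, r, σ, hw, hd, hdM, hf, h45, h14, rfl, hlh⟩
  have b1 := lt_hullSup
  have b2 := hullSup_lt
  have b3 := lt_hullInf
  have b4 := hullInf_lt
  have hQ := hf.pos
  have hr := hf.nonneg
  have hd1 := one_le_cast hd
  have hMd : (d : ℝ) + 1 ≤ maxDigit e w := by exact_mod_cast hdM
  have hμ2 : (2 : ℝ) ≤ maxDigit e (d :: w) := by exact_mod_cast two_le_maxDigit he _
  set μ : ℝ := 1 / (maxDigit e (d :: w) + hullSup) with hμ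
  have hμ0 : 0 ≤ μ := by positivity
  have hμ1 : μ ≤ 0.36 := by
    rw [hμ, div_le_iff₀ (by linarith)]
    linarith
  set A := wordMap f w (1 / (maxDigit e w + hullSup)) with hA
  set B := wordMap f w (1 / (d + 1 + hullInf)) with hB
  set C := wordMap f w (1 / (d + hullSup)) with hC
  set D := wordMap f w (1 / (d + μ)) with hD
  have eAB : B - A = σ * ((maxDigit e w + hullSup - (d + 1 + hullInf)) /
      (Q * ((d + 1 + hullInf + r) * (maxDigit e w + hullSup + r)))) := by
    rw [hA, hB, hf.sub_inv (by linarith) (by linarith), mul_div_assoc]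
  have eBC : C - B = σ * ((1 + hullInf - hullSup) /
      (Q * ((d + hullSup + r) * (d + 1 + hullInf + r)))) := by
    rw [hC, hB, hf.sub_inv (by linarith) (by linarith), mul_div_assoc]
    congr 2
    ring
  have eCD : D - C = σ * ((hullSup - μ) / (Q * ((d + μ + r) * (d + hullSup + r)))) := by
    rw [hC, hD, hf.sub_inv (by linarith) (by linarith), mul_div_assoc]
    congr 2
    ring
  have eAD : D - A = σ * ((maxDigit e w + hullSup - (d + μ)) /
      (Q * ((d + μ + r) * (maxDigit e w + hullSup + r)))) := by
    rw [hA, hD, hf.sub_inv (by linarith) (by linarith), mul_div_assoc]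
  have iL := gap_le_left hQ hd1 hMd hr (by
    by_cases hw1 : w = [1]
    · exact Or.inr (Or.inr (h45 hw1))
    · exact Or.inr (Or.inl (by exact_mod_cast three_le_maxDigit hw1)))
  have iR := gap_le_right hQ hd1 hr hμ0 hμ1
  have iG := gapRatio_div_le (K := K) hQ hr hf.le_one
    (show d + 1 ≤ K from hdM.trans_le (maxDigit_le heK hK w))
  have iD : (maxDigit e w + hullSup - (d + μ)) /
      (Q * ((d + μ + r) * (maxDigit e w + hullSup + r))) ≤ 1 / Q := by
    have p1 : 0 < d + μ + r := by linarith
    have p2 : 0 < maxDigit e w + hullSup + r := by linarith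
    rw [div_le_div_iff₀ (by positivity) hQ, one_mul, mul_comm]
    apply mul_le_mul_of_nonneg_left _ hQ.le
    nlinarith
  have hg0 := (mul_pos (gapRatio_pos K) (one_div_pos.2 hQ)).le.trans iG
  have iD' := (mul_le_mul_of_nonneg_left iD (gapRatio_pos K).le).trans iG
  have hR := nodeInterval_cons he hw hf h14 hd hdM.le
  have hRg := first_gap_le hQ hd1 hr (le_refl (d : ℝ))
  have hmem : maxDigit e ((d + 1) :: w) = 4 := by
    rw [maxDigit, if_neg (by omega)]
  have hL : ∃ g₁, g₁ ≤ (1 + hullInf - hullSup) /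
      (Q * ((d + hullSup + r) * (d + 1 + hullInf + r))) ∧
      (σ = 1 → NodeInterval f e A B g₁) ∧ (σ = -1 → NodeInterval f e B A g₁) := by
    have hB' : B = wordMap f w (1 / (((d + 1 : ℕ) : ℝ) +
        1 / (maxDigit e ((d + 1) :: w) + hullSup))) := by
      rw [hB, hmem, hullInf]
      push_cast
      rfl
    rcases Nat.lt_or_ge (d + 1) (maxDigit e w) with hlt | hge
    · refine ⟨_, next_gap_le hQ hd1 hr, ?_, ?_⟩
      · intro hσ
        exact ⟨w, d + 1, Q, r, σ, hw, by omega, hlt, hf, h45, h14, by push_cast; rfl,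
          Or.inl ⟨hσ, rfl, hB'⟩⟩
      · intro hσ
        exact ⟨w, d + 1, Q, r, σ, hw, by omega, hlt, hf, h45, h14, by push_cast; rfl,
          Or.inr ⟨hσ, rfl, hB'⟩⟩
    · have heq : maxDigit e w = d + 1 := by omega
      have hN := nodeInterval_cons he hw hf h14 (show 1 ≤ d + 1 by omega) heq.ge
      rw [← hB', ← heq] at hN
      refine ⟨_, first_gap_le hQ hd1 hr (show (d : ℝ) ≤ maxDigit e w by linarith), hN⟩
  obtain ⟨g₁, hg₁, hL1, hL2⟩ := hL
  rcases hlh with ⟨hσ, rfl, rfl⟩ | ⟨hσ, rfl, rfl⟩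
  · rw [hσ, one_mul] at eAB eBC eCD eAD
    refine ⟨hg0, by rw [eAD]; exact iD', B, C, _, _, hL1 hσ, hR.1 hσ, eBC, ?_, ?_, hg₁, hRg⟩
    · rw [eAB]; exact iL
    · rw [eCD]; exact iR
  · rw [hσ] at eAB eBC eCD eAD
    refine ⟨hg0, ?_, C, B, _, _, hR.2 hσ, hL2 hσ, by linarith, ?_, ?_, hRg, hg₁⟩
    · rw [show A - D = -(D - A) by ring, eAD]; simpa using iD'
    · rw [show C - D = -(D - C) by ring, eCD]; simpa using iR
    · rw [show A - B = -(B - A) by ring, eAB]; simpa using iL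

lemma IsMoebius.abs_sub_le {f : ℝ → ℝ} {Q r σ z z' : ℝ} (hf : IsMoebius f Q r σ) (hz : 0 ≤ z)
    (hz' : 0 ≤ z') : |f z - f z'| ≤ 1 / Q * |z - z'| := by
  rw [hf.sub z z' hz hz', abs_div, abs_mul]
  have hQ := hf.pos
  have hr := hf.nonneg
  have hσ : |σ| = 1 := by rcases hf.sign with h | h <;> simp [h]
  have h1 : 1 ≤ 1 + r * z := by nlinarith
  have h2 : 1 ≤ 1 + r * z' := by nlinarith
  have h3 : 1 ≤ (1 + r * z) * (1 + r * z') := by nlinarith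
  have h4 : Q ≤ Q * ((1 + r * z) * (1 + r * z')) := by nlinarith
  rw [hσ, one_mul, abs_of_pos (a := Q * _) (hQ.trans_le h4), div_mul_eq_mul_div, one_mul]
  exact div_le_div_of_nonneg_left (abs_nonneg _) hQ h4

/-- The sequences that may follow the reversed word `w` in the restricted system. -/
def AdmFrom (e : ℕ) (w : List ℕ) (t : ℕ → ℕ) : Prop :=
  t 0 ≤ maxDigit e w ∧ ∀ i, 1 ≤ t i ∧
    t (i + 1) ≤ if t i = 1 then (if i = 0 ∧ w = [] then e else 3) else 4

/-- The sequence obtained by prepending a reversed word. -/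
def prependRev : List ℕ → (ℕ → ℕ) → ℕ → ℕ
  | [], t => t
  | a :: w, t => prependRev w (consSeq a t)

lemma AdmFrom.one_le {e : ℕ} {w : List ℕ} {t : ℕ → ℕ} (h : AdmFrom e w t) (i : ℕ) : 1 ≤ t i :=
  (h.2 i).1

lemma admFrom_prependRev {e : ℕ} : ∀ {w : List ℕ} {t : ℕ → ℕ}, ValidWord e w → AdmFrom e w t →
    AdmFrom e [] (prependRev w t)
  | [], _, _, h => h
  | a :: w, t, hw, h => by
    refine admFrom_prependRev (w := w) (t := consSeq a t) hw.1 ⟨hw.2.2, fun i => ?_⟩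
    cases i with
    | zero =>
      refine ⟨hw.2.1, ?_⟩
      have := h.1
      simp only [maxDigit] at this
      simpa [consSeq] using this
    | succ i =>
      have := h.2 i
      simpa [consSeq] using this

lemma wordMap_cfVal (f : ℝ → ℝ) {e : ℕ} : ∀ {w : List ℕ} {t : ℕ → ℕ}, ValidWord e w →
    (∀ i, 1 ≤ t i) → wordMap f w (cfVal t) = f (cfVal (prependRev w t))
  | [], _, _, _ => rfl
  | a :: w, t, hw, ht => by
    rw [wordMap, prependRev, ← cfVal_consSeq hw.2.1 ht]
    exact wordMap_cfVal f hw.1 (consSeq_pos hw.2.1 ht)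

lemma nodeInterval_approx {f : ℝ → ℝ} {e K : ℕ} (he : 2 ≤ e) (heK : e ≤ K) (hK : 4 ≤ K)
    {l h g : ℝ} (hn : NodeInterval f e l h g) (hg : g ≤ h - l) :
    ∃ c, AdmFrom e [] c ∧ |f (cfVal c) - l| ≤ (h - l) / gapRatio K := by
  obtain ⟨w, d, Q, r, σ, hw, hd, hdM, hf, -, -, rfl, hlh⟩ := hn
  have b1 := lt_hullSup
  have htwo : ∀ i : ℕ, 1 ≤ (fun _ : ℕ => 2) i := fun _ => by norm_num
  refine ⟨prependRev w fun _ => 2, admFrom_prependRev hw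
    ⟨two_le_maxDigit he w, fun i => ⟨by norm_num, by norm_num⟩⟩, ?_⟩
  rw [← wordMap_cfVal f hw htwo]
  have hQ := hf.pos
  have hd1 := one_le_cast hd
  have hM : (2 : ℝ) ≤ maxDigit e w := by exact_mod_cast two_le_maxDigit he w
  have iG := gapRatio_div_le (K := K) hQ hf.nonneg hf.le_one
    (show d + 1 ≤ K from hdM.trans_le (maxDigit_le heK hK w))
  have hQ' : 1 / Q ≤ (h - l) / gapRatio K := by
    rw [le_div_iff₀ (gapRatio_pos K), mul_comm]
    exact iG.trans hg
  have key : ∀ u : ℝ, 1 ≤ u → |wordMap f w (cfVal fun _ => 2) - wordMap f w (1 / u)| ≤ 1 / Q := by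
    intro u hu
    have hu0 : 0 ≤ 1 / u := by positivity
    have hu1 : 1 / u ≤ 1 := by rw [div_le_one (by linarith)]; exact hu
    refine (hf.abs_sub_le (cfVal_nonneg htwo) hu0).trans ?_
    have h0 := cfVal_nonneg htwo
    have h1 := cfVal_le_one htwo
    exact mul_le_of_le_one_right (by positivity) (abs_le.2 ⟨by linarith, by linarith⟩)
  have hp : (0 : ℝ) ≤ 1 / (maxDigit e (d :: w) + hullSup) := by positivity
  rcases hlh with ⟨-, rfl, -⟩ | ⟨-, -, rfl⟩
  · exact (key _ (by linarith)).trans hQ'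
  · exact (key _ (by linarith)).trans hQ'

lemma isCompact_admFrom (e : ℕ) : IsCompact {c | AdmFrom e [] c} := by
  have hsub : {c | AdmFrom e [] c} ⊆ Set.pi univ fun _ : ℕ => Set.Icc 1 (max 4 e) := by
    rintro c hc i -
    refine ⟨hc.one_le i, ?_⟩
    cases i with
    | zero => exact hc.1.trans (by simp [maxDigit])
    | succ i =>
      refine (hc.2 i).2.trans ?_
      split_ifs <;> omega
  refine (isCompact_univ_pi fun _ => isCompact_Icc).of_isClosed_subset ?_ hsub
  have : {c | AdmFrom e [] c} = {c : ℕ → ℕ | c 0 ≤ 4} ∩ ⋂ i, {c : ℕ → ℕ | 1 ≤ c i} ∩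
      {c : ℕ → ℕ | c (i + 1) ≤ if c i = 1 then (if i = 0 then e else 3) else 4} := by
    ext c
    simp [AdmFrom, maxDigit]
  rw [this]
  refine (isClosed_le (continuous_apply _) continuous_const).inter (isClosed_iInter fun i =>
    (isClosed_le continuous_const (continuous_apply _)).inter
      (isClosed_le (continuous_apply _) ?_))
  exact (continuous_of_discreteTopology
    (f := fun n : ℕ => if n = 1 then (if i = 0 then e else 3) else 4)).comp (continuous_apply i)

lemma continuousOn_cfVal : ContinuousOn cfVal {c | ∀ i, 1 ≤ c i} := by
  intro c hc
  rw [ContinuousWithinAt, Metric.tendsto_nhds]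
  intro ε hε
  obtain ⟨j, hj⟩ := exists_pow_lt_of_lt_one hε (show (1 / 4 : ℝ) < 1 by norm_num)
  have hopen : IsOpen {c' : ℕ → ℕ | ∀ i ∈ Finset.range (2 * j), c' i = c i} := by
    have : {c' : ℕ → ℕ | ∀ i ∈ Finset.range (2 * j), c' i = c i} =
        ⋂ i ∈ Finset.range (2 * j), (fun c' : ℕ → ℕ => c' i) ⁻¹' {c i} := by
      ext
      simp
    rw [this]
    exact isOpen_biInter_finset fun i _ =>
      (isOpen_discrete {c i}).preimage (continuous_apply i)
  filter_upwards [mem_nhdsWithin_of_mem_nhds (hopen.mem_nhds fun i _ => rfl),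
    self_mem_nhdsWithin] with c' h1 h2
  rw [Real.dist_eq]
  exact (cfVal_agree j c' c h2 hc fun i hi => h1 i (Finset.mem_range.2 hi)).trans_lt hj

/-- Sums of points of two restricted systems fill the sum of two node intervals, provided that
each gap is at most the length of the other interval. -/
lemma exists_admFrom_sum {f f' : ℝ → ℝ} {Q r σ Q' r' σ' : ℝ} (hf : IsMoebius f Q r σ)
    (hf' : IsMoebius f' Q' r' σ') {e e' : ℕ} (he : 2 ≤ e) (he' : 2 ≤ e') {s l h g l' h' g' : ℝ}
    (h1 : NodeInterval f e l h g) (h2 : NodeInterval f' e' l' h' g') (hl : l + l' ≤ s)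
    (hh : s ≤ h + h') (hg : g ≤ h' - l') (hg' : g' ≤ h - l) :
    ∃ c c', AdmFrom e [] c ∧ AdmFrom e' [] c' ∧ l ≤ f (cfVal c) ∧ l' ≤ f' (cfVal c') ∧
      f (cfVal c) + f' (cfVal c') = s := by
  obtain ⟨K, hK, heK, heK'⟩ : ∃ K, 4 ≤ K ∧ e ≤ K ∧ e' ≤ K :=
    ⟨4 + e + e', by omega, by omega, by omega⟩
  have hS := splitFamily_nodeInterval f he heK hK
  have hS' := splitFamily_nodeInterval f' he' heK' hK
  have hκ := gapRatio_pos K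
  have hκ1 := gapRatio_le_one K
  have hcont : ∀ {f : ℝ → ℝ} {Q r σ : ℝ}, IsMoebius f Q r σ → ∀ e,
      ContinuousOn (fun c => f (cfVal c)) {c | AdmFrom e [] c} := by
    intro f Q r σ hf e
    have hfc : ContinuousOn f (Set.Ici 0) := by
      refine LipschitzOnWith.continuousOn (K := (1 / Q).toNNReal)
        (LipschitzOnWith.of_dist_le_mul fun x hx y hy => ?_)
      rw [Real.coe_toNNReal _ (by have := hf.pos; positivity)]
      exact hf.abs_sub_le hx hy
    exact hfc.comp (continuousOn_cfVal.mono fun c hc => hc.one_le)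
      fun c hc => cfVal_nonneg hc.one_le
  set S : Set ((ℕ → ℕ) × (ℕ → ℕ)) := {c | AdmFrom e [] c} ×ˢ {c | AdmFrom e' [] c} with hSdef
  have hSc : IsCompact S := (isCompact_admFrom e).prod (isCompact_admFrom e')
  have hF1 : ContinuousOn (fun p : (ℕ → ℕ) × (ℕ → ℕ) => f (cfVal p.1)) S :=
    (hcont hf e).comp continuousOn_fst fun p hp => hp.1
  have hF2 : ContinuousOn (fun p : (ℕ → ℕ) × (ℕ → ℕ) => f' (cfVal p.2)) S :=
    (hcont hf' e').comp continuousOn_snd fun p hp => hp.2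
  set G : (ℕ → ℕ) × (ℕ → ℕ) → ℝ := fun p => max |f (cfVal p.1) + f' (cfVal p.2) - s|
    (max (l - f (cfVal p.1)) (l' - f' (cfVal p.2))) with hG
  have hGc : ContinuousOn G S := by
    apply ContinuousOn.sup
    · exact ((hF1.add hF2).sub continuousOn_const).abs
    · exact (continuousOn_const.sub hF1).sup (continuousOn_const.sub hF2)
  have happ : ∀ N : ℕ, ∃ p ∈ S, G p ≤
      (1 - gapRatio K) ^ N * (((h - l) + (h' - l')) * (1 + 1 / gapRatio K)) := by
    intro N
    obtain ⟨l₁, h₁, g₁, l₂, h₂, g₂, k1, k2, k3, k4, k5, k6, k7, k8, k9⟩ :=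
      hS.exists_small hκ1 hS' h1 h2 hl hh hg hg' N
    obtain ⟨a0, -, x, y, -, -, -, -, a1, a2, a3, -⟩ := hS _ _ _ k1
    obtain ⟨b0, -, x', y', -, -, -, -, b1, b2, b3, -⟩ := hS' _ _ _ k2
    obtain ⟨c, hc, hc1⟩ := nodeInterval_approx he heK hK k1 (by linarith)
    obtain ⟨c', hc', hc1'⟩ := nodeInterval_approx he' heK' hK k2 (by linarith)
    refine ⟨(c, c'), ⟨hc, hc'⟩, ?_⟩
    have hb : ((h₁ - l₁) + (h₂ - l₂)) * (1 + 1 / gapRatio K) ≤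
        (1 - gapRatio K) ^ N * (((h - l) + (h' - l')) * (1 + 1 / gapRatio K)) := by
      rw [← mul_assoc]
      exact mul_le_mul_of_nonneg_right k9 (by positivity)
    refine le_trans ?_ hb
    have e1 : (h₁ - l₁ + (h₂ - l₂)) * (1 + 1 / gapRatio K) =
      (h₁ - l₁ + (h₂ - l₂)) + ((h₁ - l₁) / gapRatio K + (h₂ - l₂) / gapRatio K) := by ring
    have p1 : 0 ≤ (h₁ - l₁) / gapRatio K := div_nonneg (by linarith) hκ.le
    have p2 : 0 ≤ (h₂ - l₂) / gapRatio K := div_nonneg (by linarith) hκ.le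
    rw [e1]
    obtain ⟨d1, d2⟩ := abs_le.1 hc1
    obtain ⟨d3, d4⟩ := abs_le.1 hc1'
    refine max_le (abs_le.2 ⟨?_, ?_⟩) (max_le ?_ ?_) <;> simp only <;> linarith
  obtain ⟨p0, hp0, -⟩ := happ 0
  obtain ⟨p, hp, hmin⟩ := hSc.exists_isMinOn ⟨p0, hp0⟩ hGc
  have hGp : G p ≤ 0 := by
    have ht : Tendsto (fun N : ℕ => (1 - gapRatio K) ^ N *
        (((h - l) + (h' - l')) * (1 + 1 / gapRatio K))) atTop (nhds 0) := by
      simpa using (tendsto_pow_atTop_nhds_zero_of_lt_one (by linarith : 0 ≤ 1 - gapRatio K)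
        (by linarith)).mul_const (((h - l) + (h' - l')) * (1 + 1 / gapRatio K))
    refine ge_of_tendsto' ht fun N => ?_
    obtain ⟨q, hq, hq'⟩ := happ N
    exact (isMinOn_iff.1 hmin q hq).trans hq'
  obtain ⟨i1, i2⟩ := max_le_iff.1 hGp
  obtain ⟨i2, i3⟩ := max_le_iff.1 i2
  exact ⟨p.1, p.2, hp.1, hp.2, by linarith, by linarith,
    by linarith [abs_eq_zero.1 (le_antisymm i1 (abs_nonneg _))]⟩

/-! ### Balanced sums -/

lemma IsMoebius.sub_step {f : ℝ → ℝ} {Q r u u' : ℝ} (hf : IsMoebius f Q r 1) (hu : 0 < u)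
    (hu' : 0 < u') : f (1 / (1 + 1 / u)) - f (1 / (1 + 1 / u')) =
      (u - u') / (Q * ((1 + (1 + r) * u) * (1 + (1 + r) * u'))) := by
  rw [hf.sub_inv (by positivity) (by positivity)]
  have := hf.pos
  have := hf.nonneg
  have h1 : 0 < 1 + (1 + r) * u := by positivity
  have h2 : 0 < 1 + (1 + r) * u' := by positivity
  have e1 : 1 + 1 / u + r = (1 + (1 + r) * u) / u := by field_simp; ring
  have e2 : 1 + 1 / u' + r = (1 + (1 + r) * u') / u' := by field_simp; ring
  rw [e1, e2]
  field_simp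
  ring

/-- The intervals which cover the gap between `[0; 1, k - 1, …]` and `[0; 1, k, …]`. -/
lemma cover_gap {f : ℝ → ℝ} {Q r κ p y₁ y₀ : ℝ} (hf : IsMoebius f Q r 1) (hr : r ≤ 1 / 4)
    (hκ : 4 ≤ κ) (hp : 0.736 ≤ p) (hp' : p ≤ 0.737) (hy₁ : y₁ ≤ 0.56) (hy₀ : 0.45 ≤ y₀)
    (hy : y₀ ≤ y₁) {F : ℝ → ℝ} (hF : F = fun u => f (1 / (1 + 1 / u))) :
    F (κ + hullInf) - F (κ - 1 + hullSup) ≤ F (κ - 1 + hullSup) - F (κ - 1 + hullInf) ∧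
    F (κ + hullInf) - F (κ - 1 + hullSup) ≤ F (κ + p) - F (κ + hullInf) ∧
    F (κ - 1 + y₁) - F (κ - 1 + y₀) ≤ F (κ + p) - F (κ + hullInf) ∧
    F (κ + y₁) - F (κ + y₀) ≤ F (κ - 1 + hullSup) - F (κ - 1 + hullInf) := by
  have b1 := lt_hullSup
  have b2 := hullSup_lt
  have b3 := lt_hullInf
  have b4 := hullInf_lt
  have hQ := hf.pos
  have hr0 := hf.nonneg
  obtain ⟨ρ, hρ⟩ : ∃ ρ, ρ = 1 + r := ⟨_, rfl⟩
  have hd : ∀ u u', 0 < u → 0 < u' →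
      F u - F u' = (u - u') / (Q * ((1 + ρ * u) * (1 + ρ * u'))) := by
    intro u u' hu hu'
    rw [hF, hρ]
    exact hf.sub_step hu hu'
  have hpos : ∀ u, 0 < u → 0 < 1 + ρ * u := by
    intro u hu
    have : 0 < ρ := by linarith
    positivity
  have key : ∀ u v u' v' : ℝ, 0 < u → 0 < v → 0 < u' → 0 < v' →
      (u - v) * ((1 + ρ * u') * (1 + ρ * v')) ≤ (u' - v') * ((1 + ρ * u) * (1 + ρ * v)) →
      F u - F v ≤ F u' - F v' := by
    intro u v u' v' hu hv hu' hv' h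
    have a1 := hpos u hu
    have a2 := hpos v hv
    have a3 := hpos u' hu'
    have a4 := hpos v' hv'
    rw [hd u v hu hv, hd u' v' hu' hv', div_le_div_iff₀ (by positivity) (by positivity)]
    nlinarith
  have hρ1 : 1 ≤ ρ := by linarith
  have hρ2 : ρ ≤ 5 / 4 := by linarith
  obtain ⟨t, ht⟩ : ∃ t, t = 1 + ρ * (κ - 1) := ⟨_, rfl⟩
  have ht4 : 1 + 3 * ρ ≤ t := by rw [ht]; nlinarith
  have e1 : ∀ z, 1 + ρ * (κ + z) = t + ρ + ρ * z := fun z => by rw [ht]; ring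
  have e2 : ∀ z, 1 + ρ * (κ - 1 + z) = t + ρ * z := fun z => by rw [ht]; ring
  have hρX : 0 ≤ ρ * (hullSup - 0.79) := mul_nonneg (by linarith) (by linarith)
  have hρX' : 0 ≤ ρ * (0.792 - hullSup) := mul_nonneg (by linarith) (by linarith)
  have hρm : 0 ≤ ρ * (hullInf - 0.208) := mul_nonneg (by linarith) (by linarith)
  have hρm' : 0 ≤ ρ * (0.209 - hullInf) := mul_nonneg (by linarith) (by linarith)
  have hρp : 0 ≤ ρ * (p - 0.736) := mul_nonneg (by linarith) (by linarith)
  have hρp' : 0 ≤ ρ * (0.737 - p) := mul_nonneg (by linarith) (by linarith)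
  have hρ1' : 0 ≤ ρ * (0.56 - y₁) := mul_nonneg (by linarith) (by linarith)
  have hρ0' : 0 ≤ ρ * (y₀ - 0.45) := mul_nonneg (by linarith) (by linarith)
  have hρy : 0 ≤ ρ * (y₁ - y₀) := mul_nonneg (by linarith) (by linarith)
  refine ⟨key _ _ _ _ ?_ ?_ ?_ ?_ ?_, key _ _ _ _ ?_ ?_ ?_ ?_ ?_, key _ _ _ _ ?_ ?_ ?_ ?_ ?_,
    key _ _ _ _ ?_ ?_ ?_ ?_ ?_⟩
  all_goals try linarith
  · rw [e1, e2, e2, mul_comm (t + ρ * hullSup), ← mul_assoc, ← mul_assoc]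
    apply mul_le_mul_of_nonneg_right _ (by linarith)
    exact mul_le_mul (by linarith) (by linarith) (by linarith) (by linarith)
  · rw [e1, e2, e1, mul_comm (t + ρ + ρ * hullInf) (t + ρ * hullSup), ← mul_assoc, ← mul_assoc]
    apply mul_le_mul_of_nonneg_right _ (by linarith)
    calc _ ≤ 0.418 * (t + ρ + ρ * p) := mul_le_mul_of_nonneg_right (by linarith) (by linarith)
      _ ≤ 0.527 * (t + ρ * hullSup) := by linarith
      _ ≤ _ := mul_le_mul_of_nonneg_right (by linarith) (by linarith)
  · rw [e1, e2, e2, e1]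
    calc _ ≤ 0.11 * ((t + ρ + ρ * p) * (t + ρ + ρ * hullInf)) :=
          mul_le_mul_of_nonneg_right (by linarith) (mul_nonneg (by linarith) (by linarith))
      _ ≤ 0.11 * ((2 * (t + ρ * y₁)) * (2 * (t + ρ * y₀))) := by
          apply mul_le_mul_of_nonneg_left _ (by norm_num)
          exact mul_le_mul (by linarith) (by linarith) (by linarith) (by linarith)
      _ = 0.44 * ((t + ρ * y₁) * (t + ρ * y₀)) := by ring
      _ ≤ _ := mul_le_mul_of_nonneg_right (by linarith) (mul_nonneg (by linarith) (by linarith))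
  · rw [e1, e2, e2, e1]
    exact mul_le_mul (by linarith) (mul_le_mul (by linarith) (by linarith) (by linarith)
      (by linarith)) (mul_nonneg (by linarith) (by linarith)) (by linarith)

lemma AdmFrom.mono {e E : ℕ} {c : ℕ → ℕ} (h : AdmFrom e [] c) (heE : e ≤ E) :
    AdmFrom E [] c := by
  refine ⟨h.1, fun i => ⟨h.one_le i, (h.2 i).2.trans ?_⟩⟩
  split_ifs <;> omega

lemma AdmFrom.cfVal_le {e : ℕ} {c : ℕ → ℕ} (h : AdmFrom e [] c) :
    cfVal c ≤ ((e : ℝ) + 1) / (e + 2) := by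
  have h0 := h.one_le
  have he : (0 : ℝ) ≤ e := Nat.cast_nonneg e
  by_cases hc : c 0 = 1
  · have h1 := (h.2 0).2
    simp only [hc, if_true, true_and] at h1
    have h2 : (c (0 + 1) : ℝ) ≤ e := by exact_mod_cast h1
    have h3 := inv_le_cfVal fun i => h0 (i + 1)
    have h4 : (1 : ℝ) / (e + 1) ≤ cfVal fun i => c (i + 1) :=
      (one_div_le_one_div_of_le (by positivity) (by linarith)).trans h3
    rw [cfVal_eq h0, hc, Nat.cast_one]
    have h5 : (1 : ℝ) / (1 + 1 / (e + 1)) = (e + 1) / (e + 2) := by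
      field_simp
      ring
    rw [← h5]
    exact one_div_le_one_div_of_le (by positivity) (by linarith)
  · have h1 : 2 ≤ c 0 := by have := h0 0; omega
    have h2 : (2 : ℝ) ≤ c 0 := by exact_mod_cast h1
    refine (cfVal_le_inv h0).trans ?_
    rw [div_le_div_iff₀ (by linarith) (by linarith)]
    nlinarith

lemma NodeInterval.gap_le {f : ℝ → ℝ} {e : ℕ} {l h g : ℝ} (he : 2 ≤ e)
    (hn : NodeInterval f e l h g) : g ≤ h - l := by
  obtain ⟨a0, -, x, y, -, -, -, -, a1, a2, a3, -⟩ :=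
    splitFamily_nodeInterval f he (show e ≤ 4 + e by omega) (by omega) _ _ _ hn
  linarith

/-- The interval of the whole restricted system. -/
lemma nodeInterval_root {f : ℝ → ℝ} {Q r : ℝ} (hf : IsMoebius f Q r 1) (hr : r ≤ 1 / 4) (e : ℕ) :
    NodeInterval f e (f hullInf) (f (1 / (1 + 1 / (e + hullSup))))
      (f (1 / (1 + hullSup)) - f (1 / (2 + hullInf))) := by
  have b1 := lt_hullSup
  have b3 := lt_hullInf
  refine ⟨[], 1, Q, r, 1, trivial, le_rfl, by simp [maxDigit], hf, by simp, fun _ => hr, ?_,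
    Or.inl ⟨rfl, by simp [maxDigit, wordMap, hullInf], by simp [maxDigit, wordMap]⟩⟩
  rw [hf.sub_inv (by linarith) (by linarith)]
  push_cast
  ring

/-- The interval of the values beginning with `[0; 1, a]`. -/
lemma nodeInterval_one {f : ℝ → ℝ} {Q r : ℝ} (hf : IsMoebius f Q r 1) {e a : ℕ} (ha : 2 ≤ a)
    (hae : a ≤ e) :
    NodeInterval f e (f (1 / (1 + 1 / (a + hullInf)))) (f (1 / (1 + 1 / (a + hullSup))))
      (f (1 / (1 + 1 / (a + 1 / (1 + hullSup)))) - f (1 / (1 + 1 / (a + 1 / (2 + hullInf))))) := by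
  have b1 := lt_hullSup
  have b3 := lt_hullInf
  have ha1 : a ≠ 1 := by omega
  have h1 := (hf.comp_inv (le_refl (1 : ℝ))).comp_inv (one_le_cast (show 1 ≤ a by omega))
  rw [neg_neg] at h1
  have hw : wordMap f [a, 1] = fun z => f (1 / (1 + 1 / (a + z))) := by
    ext z
    simp [wordMap]
  refine ⟨[a, 1], 1, _, _, 1, ?_, le_rfl, by simp [maxDigit, ha1], by rw [hw]; exact h1,
    by simp, by simp, ?_, Or.inl ⟨rfl, ?_, ?_⟩⟩
  · simp [ValidWord, maxDigit]
    omega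
  · have := h1.sub_inv (t := 1 + hullSup) (t' := 2 + hullInf) (by linarith) (by linarith)
    rw [this]
    push_cast
    ring
  · simp [maxDigit, hw, ha1, hullInf]
  · have := hullSup_eq
    simp only [maxDigit, hw, reduceCtorEq, if_false, if_true, Nat.cast_ofNat, Nat.cast_one, this]

lemma exists_balanced_sum {k : ℕ} (hk : 4 ≤ k) {s x : ℝ} (hx : 0 ≤ x) (hxφ : stepMap k x = x)
    (hs : 1 ≤ s) (hsx : s < 2 * x) :
    ∃ n n' c c', AdmFrom (k - 1) [] c ∧ AdmFrom (k - 1) [] c' ∧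
      (stepMap k)^[n] (cfVal c) + (stepMap k)^[n'] (cfVal c') = s ∧
      (stepMap k)^[n] (cfVal c) ≤ stepMap k ((stepMap k)^[n'] (cfVal c')) ∧
      (stepMap k)^[n'] (cfVal c') ≤ stepMap k ((stepMap k)^[n] (cfVal c)) := by
  have b1 := lt_hullSup
  have b2 := hullSup_lt
  have b3 := lt_hullInf
  have b4 := hullInf_lt
  have hκ : (4 : ℝ) ≤ k := by exact_mod_cast hk
  have hκ1 : (1 : ℝ) ≤ k := by linarith
  have hm0 : 0 ≤ hullInf := by linarith
  have hk1 : ((k - 1 : ℕ) : ℝ) = k - 1 := by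
    rw [Nat.cast_sub (by omega), Nat.cast_one]
  have hle : ∀ c, AdmFrom (k - 1) [] c → ∀ z, 0 ≤ z → cfVal c ≤ stepMap k z := by
    intro c hc z hz
    refine (hc.cfVal_le.trans_eq ?_).trans (le_stepMap hκ1 hz)
    rw [hk1]
    congr 1 <;> ring
  have hxm : hullInf ≤ x := by linarith
  have hex : ∃ n, s < 2 * (stepMap k)^[n + 1] hullInf := by
    obtain ⟨n, hn⟩ := exists_pow_lt_of_lt_one (show 0 < x - s / 2 by linarith)
      (show (1 / 4 : ℝ) < 1 by norm_num)
    refine ⟨n, ?_⟩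
    have h1 := stepMap_iter_sub_le hκ1 hm0 hxm (n + 1)
    rw [Function.iterate_fixed hxφ] at h1
    have h2 : (x - hullInf) * (1 / 4) ^ (n + 1) ≤ (1 / 4) ^ n := by
      have hx1 : x ≤ 1 := by
        rw [← hxφ, stepMap_eq hκ1 hx, div_le_one (by linarith)]
        linarith
      rw [pow_succ]
      have : (0 : ℝ) < (1 / 4) ^ n := by positivity
      nlinarith
    linarith
  classical
  obtain ⟨n, hn, hmin⟩ : ∃ n, s < 2 * (stepMap k)^[n + 1] hullInf ∧
      2 * (stepMap k)^[n] hullInf ≤ s := by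
    refine ⟨Nat.find hex, Nat.find_spec hex, ?_⟩
    rcases hN : Nat.find hex with _ | N
    · simp only [Function.iterate_zero, id]
      linarith
    · exact not_lt.1 (Nat.find_min hex (m := N) (by omega))
  obtain ⟨Q, r, hr, hf⟩ := isMoebius_iterate hκ n
  obtain ⟨Q', r', hr', hf'⟩ := isMoebius_iterate hκ (n + 1)
  have hroot := nodeInterval_root hf hr (k - 1)
  rw [hk1] at hroot
  have he : 2 ≤ k - 1 := by omega
  rcases le_or_gt s (2 * (stepMap k)^[n] (1 / (1 + 1 / (k - 1 + hullSup)))) with hs2 | hs2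
  · have hg := hroot.gap_le he
    obtain ⟨c, c', hc, hc', -, -, hsum⟩ := exists_admFrom_sum hf hf he he hroot hroot
      (s := s) (by linarith) (by linarith) hg hg
    refine ⟨n, n, c, c', hc, hc', hsum, ?_, ?_⟩
    · rw [← Function.iterate_succ_apply' (stepMap k), Function.iterate_succ_apply]
      exact (stepMap_iter_le_iff hκ1 (cfVal_nonneg hc.one_le)
        (stepMap_nonneg hκ1 (cfVal_nonneg hc'.one_le)) n).2 (hle c hc _ (cfVal_nonneg hc'.one_le))
    · rw [← Function.iterate_succ_apply' (stepMap k), Function.iterate_succ_apply]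
      exact (stepMap_iter_le_iff hκ1 (cfVal_nonneg hc'.one_le)
        (stepMap_nonneg hκ1 (cfVal_nonneg hc.one_le)) n).2 (hle c' hc' _ (cfVal_nonneg hc.one_le))
  · have hU := nodeInterval_one hf he (le_refl (k - 1))
    have hV := nodeInterval_root hf' hr' 2
    rw [hk1] at hU
    have hp1 : 0.736 ≤ 1 / (1 + 1 / (((2 : ℕ) : ℝ) + hullSup)) := by
      have : 1 / (((2 : ℕ) : ℝ) + hullSup) ≤ 0.3583 := by
        push_cast
        rw [div_le_iff₀ (by linarith)]
        linarith
      have : 0 < 1 / (((2 : ℕ) : ℝ) + hullSup) := by positivity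
      rw [le_div_iff₀ (by linarith)]
      linarith
    have hp2 : 1 / (1 + 1 / (((2 : ℕ) : ℝ) + hullSup)) ≤ 0.737 := by
      have : 0.358 ≤ 1 / (((2 : ℕ) : ℝ) + hullSup) := by
        push_cast
        rw [le_div_iff₀ (by linarith)]
        linarith
      rw [div_le_iff₀ (by linarith)]
      linarith
    have hy1 : 1 / (1 + hullSup) ≤ 0.56 := by
      rw [div_le_iff₀ (by linarith)]
      linarith
    have hy0 : 0.45 ≤ 1 / (2 + hullInf) := by
      rw [le_div_iff₀ (by linarith)]
      linarith
    have hy : 1 / (2 + hullInf) ≤ 1 / (1 + hullSup) :=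
      one_div_le_one_div_of_le (by linarith) (by linarith)
    obtain ⟨g1, g2, g3, g4⟩ := cover_gap hf hr hκ hp1 hp2 hy1 hy0 hy rfl
    have hstep : ∀ z, (stepMap k)^[n] (1 / (1 + 1 / (k + z))) = (stepMap k)^[n + 1] z :=
      fun z => rfl
    simp only [hstep] at g1 g2 g3 g4
    obtain ⟨c, c', hc, hc', hcl, -, hsum⟩ := exists_admFrom_sum hf hf' he le_rfl hU hV
      (s := s) (by linarith) (by linarith) g3 g4
    have hcl' := (stepMap_iter_le_iff hκ1 (by
      have : (0 : ℝ) < k - 1 + hullInf := by linarith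
      positivity) (cfVal_nonneg hc.one_le) n).1 hcl
    have hcc : cfVal c' ≤ cfVal c := by
      refine hc'.cfVal_le.trans (le_trans ?_ hcl')
      have : 1 / (k - 1 + hullInf) ≤ 1 / 3 := one_div_le_one_div_of_le (by norm_num) (by linarith)
      have h0 : 0 < 1 / (k - 1 + hullInf) := one_div_pos.2 (by linarith)
      rw [le_div_iff₀ (by linarith)]
      norm_num
      norm_num at this
      linarith
    refine ⟨n, n + 1, c, c', hc, hc'.mono he, hsum, ?_, ?_⟩
    · rw [← Function.iterate_succ_apply' (stepMap k), Function.iterate_succ_apply,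
        Function.iterate_succ_apply]
      have h0 := stepMap_nonneg hκ1 (cfVal_nonneg hc'.one_le)
      exact (stepMap_iter_le_iff hκ1 (cfVal_nonneg hc.one_le) (stepMap_nonneg hκ1 h0) n).2
        (hle c hc _ h0)
    · rw [← Function.iterate_succ_apply' (stepMap k)]
      exact (stepMap_iter_le_iff hκ1 (cfVal_nonneg hc'.one_le) (cfVal_nonneg hc.one_le) (n + 1)).2
        hcc

/-! ### Bi-infinite sequences -/

/-- The sequence `1, k, 1, k, …, 1, k` (with `n` periods) followed by `c`. -/
def corePrefix (k : ℕ) : ℕ → (ℕ → ℕ) → ℕ → ℕ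
  | 0, c => c
  | n + 1, c => consSeq 1 (consSeq k (corePrefix k n c))

lemma corePrefix_mem {k : ℕ} (hk : 1 ≤ k) {c : ℕ → ℕ} (hc : ∀ i, 1 ≤ c i ∧ c i ≤ k) :
    ∀ n i, 1 ≤ corePrefix k n c i ∧ corePrefix k n c i ≤ k
  | 0, i => hc i
  | _ + 1, 0 => ⟨le_rfl, hk⟩
  | _ + 1, 1 => ⟨hk, le_rfl⟩
  | n + 1, i + 2 => corePrefix_mem hk hc n i

lemma cfVal_corePrefix {k : ℕ} (hk : 1 ≤ k) {c : ℕ → ℕ} (hc : ∀ i, 1 ≤ c i ∧ c i ≤ k) (n : ℕ) :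
    cfVal (corePrefix k n c) = (stepMap k)^[n] (cfVal c) := by
  induction n with
  | zero => rfl
  | succ n ih =>
    have h := fun i => (corePrefix_mem hk hc n i).1
    rw [corePrefix, cfVal_consSeq le_rfl (consSeq_pos hk h), cfVal_consSeq hk h, ih,
      Function.iterate_succ_apply', Nat.cast_one]
    rfl

/-- The values `[0; A (i - 1), …, A 0, 1 / y]`. -/
def leftVal (A : ℕ → ℕ) (y : ℝ) : ℕ → ℝ
  | 0 => y
  | i + 1 => 1 / (A i + leftVal A y i)

lemma leftVal_nonneg {A : ℕ → ℕ} {y : ℝ} (hy : 0 ≤ y) (i : ℕ) : 0 ≤ leftVal A y i := by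
  induction i with
  | zero => exact hy
  | succ i ih =>
    rw [leftVal]
    positivity

lemma leftVal_add_two (A : ℕ → ℕ) (y : ℝ) (i : ℕ) :
    leftVal A y (i + 2) = leftVal (fun j => A (j + 2)) (leftVal A y 2) i := by
  induction i with
  | zero => rfl
  | succ i ih => rw [leftVal, ih]; rfl

lemma leftVal_succ_le {A : ℕ → ℕ} {y : ℝ} (hy : 0 ≤ y) {d i : ℕ} (hd : 1 ≤ d) (h : d ≤ A i) :
    leftVal A y (i + 1) ≤ 1 / d := by
  have h1 := leftVal_nonneg (A := A) hy i
  have h2 : (d : ℝ) ≤ A i := by exact_mod_cast h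
  have h3 := one_le_cast hd
  rw [leftVal]
  exact one_div_le_one_div_of_le (by linarith) (by linarith)

lemma leftVal_le_one {A : ℕ → ℕ} (hA : ∀ i, 1 ≤ A i) {y : ℝ} (hy : 0 ≤ y) (hy1 : y ≤ 1) (i : ℕ) :
    leftVal A y i ≤ 1 := by
  cases i with
  | zero => exact hy1
  | succ i => simpa using leftVal_succ_le (A := A) hy le_rfl (hA i)

lemma AdmFrom.le {e : ℕ} {c : ℕ → ℕ} (h : AdmFrom e [] c) (i : ℕ) : c i ≤ max 4 e := by
  cases i with
  | zero => exact h.1.trans (by simp [maxDigit])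
  | succ i =>
    refine (h.2 i).2.trans ?_
    split_ifs <;> omega

lemma tail_lam_le {k : ℕ} (hk : 4 ≤ k) {c : ℕ → ℕ} (hc : AdmFrom (k - 1) [] c) {y T : ℝ}
    (hy : 0 ≤ y) (hy1 : y ≤ 1 / 2) (hT : (k : ℝ) + 1 + 2 / (k + 2) ≤ T) (i : ℕ) :
    c i + cfVal (fun j => c (i + 1 + j)) + leftVal c y i ≤ T := by
  have h0 := hc.one_le
  have hR1 := cfVal_le_one fun j => h0 (i + 1 + j)
  have hL1 := leftVal_le_one h0 hy (by linarith) i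
  have hpos : (0 : ℝ) < 2 / (k + 2) := by positivity
  by_cases hck : c i ≤ k - 1
  · have : (c i : ℝ) ≤ k - 1 := by
      rw [le_sub_iff_add_le]
      exact_mod_cast (show c i + 1 ≤ k by omega)
    linarith
  · have hle := hc.le
    have h4 := hle i
    obtain rfl : k = 4 := by omega
    have hci : c i = 4 := by omega
    have hL : leftVal c y i ≤ 1 / 2 := by
      cases i with
      | zero => exact hy1
      | succ i =>
        have h2 := hc.2 i
        have h3 : 2 ≤ c i := by
          by_contra hcon
          have : c i = 1 := by omega
          rw [if_pos this] at h2
          split_ifs at h2 <;> omega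
        exact_mod_cast leftVal_succ_le hy (by norm_num) h3
    have hR : cfVal (fun j => c (i + 1 + j)) ≤ 5 / 6 := by
      have h5 : (1 : ℝ) ≤ c (i + 1 + 0) := one_le_cast (h0 _)
      have h6 : (c (i + 1 + (0 + 1)) : ℝ) ≤ 4 := by exact_mod_cast hle _
      have h7 := inv_le_cfVal fun j => h0 (i + 1 + (j + 1))
      have h8 : (1 : ℝ) / 5 ≤ cfVal fun j => c (i + 1 + (j + 1)) :=
        (one_div_le_one_div_of_le (by positivity) (by linarith)).trans h7
      rw [cfVal_eq fun j => h0 (i + 1 + j), div_le_div_iff₀ (by linarith) (by norm_num)]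
      linarith
    rw [hci]
    norm_num at hT ⊢
    linarith

lemma corePrefix_lam_le {k : ℕ} (hk : 4 ≤ k) {c : ℕ → ℕ} (hc : AdmFrom (k - 1) [] c) {T : ℝ}
    (hT : (k : ℝ) + 1 + 2 / (k + 2) ≤ T) : ∀ (n : ℕ) {b : ℝ}, 0 ≤ b →
    (∀ j m, m + (j + 1) = n → (stepMap k)^[j + 1] b + (stepMap k)^[m] (cfVal c) ≤ T - k) → ∀ i,
    corePrefix k n c i + cfVal (fun j => corePrefix k n c (i + 1 + j)) +
      leftVal (corePrefix k n c) (1 / (k + b)) i ≤ T := by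
  have hκ : (4 : ℝ) ≤ k := by exact_mod_cast hk
  have hck : ∀ i, 1 ≤ c i ∧ c i ≤ k := fun i => ⟨hc.one_le i, (hc.le i).trans (by omega)⟩
  have hpos : (0 : ℝ) < 2 / (k + 2) := by positivity
  have hy : ∀ {b : ℝ}, 0 ≤ b → 0 ≤ 1 / (k + b) ∧ 1 / (k + b) ≤ 1 / 2 := fun hb =>
    ⟨by positivity, one_div_le_one_div_of_le (by norm_num) (by linarith)⟩
  intro n
  induction n with
  | zero =>
    intro b hb _ i
    exact tail_lam_le hk hc (hy hb).1 (hy hb).2 hT i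
  | succ n ih =>
    intro b hb hj i
    have hA := corePrefix_mem (by omega) hck (n + 1)
    match i with
    | 0 =>
      have h1 := cfVal_le_one fun j => (hA (0 + 1 + j)).1
      have h2 : (corePrefix k (n + 1) c 0 : ℝ) = 1 := by simp [corePrefix, consSeq]
      rw [h2, leftVal]
      linarith [(hy hb).2]
    | 1 =>
      have h1 : (fun j => corePrefix k (n + 1) c (1 + 1 + j)) = corePrefix k n c := by
        ext j
        rw [show 1 + 1 + j = j + 2 by ring]
        rfl
      have h2 : (corePrefix k (n + 1) c 1 : ℝ) = k := rfl
      have h3 : leftVal (corePrefix k (n + 1) c) (1 / (k + b)) 1 = stepMap k b := by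
        simp [leftVal, corePrefix, consSeq, stepMap]
      rw [h1, h2, h3, cfVal_corePrefix (by omega) hck]
      have := hj 0 n rfl
      rw [zero_add, Function.iterate_one] at this
      linarith
    | i + 2 =>
      have h1 : leftVal (corePrefix k (n + 1) c) (1 / (k + b)) 2 = 1 / (k + stepMap k b) := by
        simp [leftVal, corePrefix, consSeq, stepMap]
      have h2 : (fun j => corePrefix k (n + 1) c (i + 2 + 1 + j)) =
          fun j => corePrefix k n c (i + 1 + j) := by
        ext j
        rw [show i + 2 + 1 + j = (i + 1 + j) + 2 by ring]
        rfl
      rw [leftVal_add_two, h1, h2]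
      refine ih (stepMap_nonneg (by linarith) hb) (fun j m hm => ?_) i
      rw [← Function.iterate_succ_apply]
      exact hj (j + 1) m (by omega)

/-- The bi-infinite sequence with central term `k` continued by `A` to the right and by `B` to the
left. -/
def glue (k : ℕ) (A B : ℕ → ℕ) : ℤ → ℕ
  | .ofNat 0 => k
  | .ofNat (n + 1) => A n
  | .negSucc n => B n

lemma glue_mem {P : ℕ → Prop} {k : ℕ} {A B : ℕ → ℕ} (hk : P k) (hA : ∀ i, P (A i))
    (hB : ∀ i, P (B i)) : ∀ i, P (glue k A B i)
  | .ofNat 0 => hk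
  | .ofNat (n + 1) => hA n
  | .negSucc n => hB n

lemma glue_neg (k : ℕ) (A B : ℕ → ℕ) : ∀ i, glue k A B (-i) = glue k B A i
  | .ofNat 0 => rfl
  | .ofNat (_ + 1) => rfl
  | .negSucc _ => rfl

lemma glue_natCast_succ (k : ℕ) (A B : ℕ → ℕ) (n : ℕ) : glue k A B ((n : ℤ) + 1) = A n := rfl

lemma glue_sub_one (k : ℕ) (A B : ℕ → ℕ) (n : ℕ) : glue k A B (-1 - n) = B n := by
  rw [show (-1 - n : ℤ) = Int.negSucc n by rw [Int.negSucc_eq]; ring]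
  rfl

lemma lamCF_neg (θ : ℤ → ℕ) (i : ℤ) : lamCF (fun j => θ (-j)) i = lamCF θ (-i) := by
  unfold lamCF
  have h1 : (fun n : ℕ => θ (-(i + 1 + n))) = fun n : ℕ => θ (-i - 1 - n) := by
    ext n
    congr 1
    ring
  have h2 : (fun n : ℕ => θ (-(i - 1 - n))) = fun n : ℕ => θ (-i + 1 + n) := by
    ext n
    congr 1
    ring
  rw [h1, h2]
  ring

lemma lamCF_glue_zero (k : ℕ) (A B : ℕ → ℕ) :
    lamCF (glue k A B) 0 = k + cfVal A + cfVal B := by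
  have h1 : (fun n : ℕ => glue k A B (0 + 1 + n)) = A := by
    ext n
    rw [zero_add, add_comm, glue_natCast_succ]
  have h2 : (fun n : ℕ => glue k A B (0 - 1 - n)) = B := by
    ext n
    rw [zero_sub, glue_sub_one]
  rw [lamCF, h1, h2]
  rfl

lemma lamCF_glue_succ {k : ℕ} {A B : ℕ → ℕ} (hk : 1 ≤ k) (hA : ∀ i, 1 ≤ A i) (hB : ∀ i, 1 ≤ B i)
    (i : ℕ) : lamCF (glue k A B) (i + 1) =
      A i + cfVal (fun j => A (i + 1 + j)) + leftVal A (1 / (k + cfVal B)) i := by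
  have hθ := glue_mem (P := fun n => 1 ≤ n) hk hA hB
  have hL : ∀ p : ℕ, cfVal (fun n : ℕ => glue k A B (p - n)) =
      leftVal A (1 / (k + cfVal B)) p := by
    intro p
    rw [cfVal_eq fun n => hθ _]
    induction p with
    | zero =>
      have : (fun i : ℕ => glue k A B (((0 : ℕ) : ℤ) - ((i + 1 : ℕ) : ℤ))) = B := by
        ext i
        rw [← glue_sub_one k A B i]
        congr 1
        push_cast
        ring
      rw [this]
      rfl
    | succ p ih =>
      have : (fun i : ℕ => glue k A B (((p + 1 : ℕ) : ℤ) - ((i + 1 : ℕ) : ℤ))) =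
          fun i : ℕ => glue k A B (p - i) := by
        ext i
        congr 1
        push_cast
        ring
      rw [this, cfVal_eq fun n => hθ _, ih, leftVal]
      rfl
  have h1 : (fun n : ℕ => glue k A B ((i : ℤ) + 1 + 1 + n)) = fun j => A (i + 1 + j) := by
    ext n
    rw [← glue_natCast_succ k A B]
    congr 1
    push_cast
    ring
  have h2 : (fun n : ℕ => glue k A B ((i : ℤ) + 1 - 1 - n)) = fun n : ℕ => glue k A B (i - n) := by
    ext n
    congr 1
    ring
  rw [lamCF, h1, h2, hL, glue_natCast_succ]

lemma lamCF_glue_le {k : ℕ} {A B : ℕ → ℕ} (hk : 1 ≤ k) (hA : ∀ i, 1 ≤ A i) (hB : ∀ i, 1 ≤ B i)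
    {T : ℝ} (h0 : k + cfVal A + cfVal B ≤ T)
    (h1 : ∀ i, A i + cfVal (fun j => A (i + 1 + j)) + leftVal A (1 / (k + cfVal B)) i ≤ T)
    (h2 : ∀ i, B i + cfVal (fun j => B (i + 1 + j)) + leftVal B (1 / (k + cfVal A)) i ≤ T) :
    ∀ i, lamCF (glue k A B) i ≤ T
  | .ofNat 0 => (lamCF_glue_zero k A B).trans_le h0
  | .ofNat (i + 1) => (lamCF_glue_succ hk hA hB i).trans_le (h1 i)
  | .negSucc i => by
    have h3 := lamCF_glue_succ hk hB hA i
    rw [← funext (glue_neg k A B), lamCF_neg] at h3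
    exact h3.trans_le (h2 i)

lemma mem_MSpecK_of_glue {k : ℕ} {A B : ℕ → ℕ} (hk : 1 ≤ k) (hA : ∀ i, 1 ≤ A i ∧ A i ≤ k)
    (hB : ∀ i, 1 ≤ B i ∧ B i ≤ k) {T : ℝ} (h0 : k + cfVal A + cfVal B = T)
    (hle : ∀ i, lamCF (glue k A B) i ≤ T) : T ∈ MSpecK k := by
  have hθ := glue_mem (P := fun n => 1 ≤ n ∧ n ≤ k) ⟨hk, le_rfl⟩ hA hB
  refine ⟨glue k A B, hθ, le_antisymm ?_ (ciSup_le hle)⟩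
  rw [← h0, ← lamCF_glue_zero]
  exact le_ciSup ⟨T, Set.forall_mem_range.2 hle⟩ 0

lemma mem_MSpecK_of_lt {k : ℕ} (hk : 4 ≤ k) {T x : ℝ} (hx : 0 ≤ x) (hxφ : stepMap k x = x)
    (hT : (k : ℝ) + 1 + 2 / (k + 2) ≤ T) (hTx : T < k + 2 * x) : T ∈ MSpecK k := by
  have hκ : (1 : ℝ) ≤ k := one_le_cast (by omega)
  have hpos : (0 : ℝ) < 2 / (k + 2) := by positivity
  obtain ⟨n, n', c, c', hc, hc', hsum, hb, hb'⟩ :=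
    exists_balanced_sum (s := T - k) hk hx hxφ (by linarith) (by linarith)
  have hck : ∀ {c}, AdmFrom (k - 1) [] c → ∀ i, 1 ≤ c i ∧ c i ≤ k :=
    fun hc i => ⟨hc.one_le i, (hc.le i).trans (by omega)⟩
  have hγ : ∀ {c}, AdmFrom (k - 1) [] c → 0 ≤ cfVal c ∧ cfVal c ≤ stepMap k (cfVal c) := by
    intro c hc
    have h0 := cfVal_nonneg hc.one_le
    refine ⟨h0, (hc.cfVal_le.trans_eq ?_).trans (le_stepMap hκ h0)⟩
    rw [Nat.cast_sub (by omega), Nat.cast_one]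
    congr 1 <;> ring
  have hcf := cfVal_corePrefix (show 1 ≤ k by omega) (hck hc) n
  have hcf' := cfVal_corePrefix (show 1 ≤ k by omega) (hck hc') n'
  have hA := corePrefix_mem (by omega) (hck hc) n
  have hB := corePrefix_mem (by omega) (hck hc') n'
  have hT0 : k + cfVal (corePrefix k n c) + cfVal (corePrefix k n' c') = T := by
    rw [hcf, hcf']
    linarith
  refine mem_MSpecK_of_glue (by omega) hA hB hT0
    (lamCF_glue_le (by omega) (fun i => (hA i).1) (fun i => (hB i).1) hT0.le ?_ ?_)
  · rw [hcf']
    refine corePrefix_lam_le hk hc hT n (stepMap_iter_nonneg hκ (hγ hc').1 n') fun j m hm => ?_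
    subst hm
    refine (shift_sum_le hκ (hγ hc).1 (stepMap_iter_nonneg hκ (hγ hc').1 n') (hγ hc).2 j m
      hb).trans ?_
    linarith
  · rw [hcf]
    refine corePrefix_lam_le hk hc' hT n' (stepMap_iter_nonneg hκ (hγ hc).1 n) fun j m hm => ?_
    subst hm
    refine (shift_sum_le hκ (hγ hc').1 (stepMap_iter_nonneg hκ (hγ hc).1 n) (hγ hc').2 j m
      hb').trans ?_
    linarith

/-! ### The initial segment -/

lemma cfVal_le_of_le {k : ℕ} (hk : 1 ≤ k) {x : ℝ} (hx : 0 ≤ x) (hx1 : x ≤ 1)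
    (hxφ : stepMap k x = x) {c : ℕ → ℕ} (hc : ∀ i, 1 ≤ c i ∧ c i ≤ k) : cfVal c ≤ x := by
  have hκ := one_le_cast hk
  have h : ∀ n, ∀ c : ℕ → ℕ, (∀ i, 1 ≤ c i ∧ c i ≤ k) → cfVal c ≤ (stepMap k)^[n] 1 := by
    intro n
    induction n with
    | zero => exact fun c hc => cfVal_le_one fun i => (hc i).1
    | succ n ih =>
      intro c hc
      have h0 := cfVal_nonneg fun i => (hc (i + 1 + 1)).1
      have h1 : (1 : ℝ) ≤ c 0 := one_le_cast (hc 0).1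
      have h2 : (1 : ℝ) ≤ c (0 + 1) := one_le_cast (hc 1).1
      have h3 : (c (0 + 1) : ℝ) ≤ k := by exact_mod_cast (hc 1).2
      rw [Function.iterate_succ_apply']
      refine le_trans ?_ ((stepMap_le_iff hκ h0 (stepMap_iter_nonneg hκ zero_le_one n)).2
        (ih _ fun i => hc (i + 1 + 1)))
      rw [cfVal_eq fun i => (hc i).1, cfVal_eq fun i => (hc (i + 1)).1, stepMap]
      have h4 := one_div_le_one_div_of_le (by linarith)
        (show (c (0 + 1) : ℝ) + cfVal (fun i => c (i + 1 + 1)) ≤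
          k + cfVal (fun i => c (i + 1 + 1)) by linarith)
      exact one_div_le_one_div_of_le (by positivity) (by linarith)
  have ht : Tendsto (fun n : ℕ => x + (1 - x) * (1 / 4 : ℝ) ^ n) atTop (nhds x) := by
    simpa using ((tendsto_pow_atTop_nhds_zero_of_lt_one (show (0 : ℝ) ≤ 1 / 4 by norm_num)
      (by norm_num)).const_mul (1 - x)).const_add x
  refine ge_of_tendsto' ht fun n => (h n c hc).trans ?_
  have h1 := stepMap_iter_sub_le hκ hx hx1 n
  rw [Function.iterate_fixed hxφ] at h1
  linarith

lemma stepMap_fixed_iff {κ x : ℝ} (hκ : 1 ≤ κ) (hx : 0 ≤ x) :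
    stepMap κ x = x ↔ x ^ 2 + κ * x = κ := by
  rw [stepMap_eq hκ hx, div_eq_iff (by linarith)]
  constructor <;> intro h <;> linarith

lemma mem_MSpecK_sqrt {k : ℕ} (hk : 1 ≤ k) {x : ℝ} (hx : 0 ≤ x) (hxφ : stepMap k x = x)
    (hle : ∀ θ : ℤ → ℕ, (∀ i, 1 ≤ θ i ∧ θ i ≤ k) → ∀ i, lamCF θ i ≤ k + 2 * x) :
    k + 2 * x ∈ MSpecK k := by
  have hκ := one_le_cast hk
  set p : ℕ → ℕ := fun i => if Even i then 1 else k with hp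
  have hpk : ∀ i, 1 ≤ p i ∧ p i ≤ k := by
    intro i
    simp only [hp]
    split_ifs <;> omega
  have h0 := cfVal_nonneg fun i => (hpk i).1
  have hfix : stepMap k (cfVal p) = cfVal p := by
    have h2 : (fun i => p (i + 1 + 1)) = p := by
      ext i
      simp [hp, add_assoc, Nat.even_add]
    conv_rhs => rw [cfVal_eq fun i => (hpk i).1, cfVal_eq fun i => (hpk (i + 1)).1, h2]
    simp [hp, stepMap]
  have hpx : cfVal p = x := by
    have e1 := (stepMap_fixed_iff hκ h0).1 hfix
    have e2 := (stepMap_fixed_iff hκ hx).1 hxφ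
    have e3 : (cfVal p - x) * (cfVal p + x + k) = 0 := by linarith
    rcases mul_eq_zero.1 e3 with h | h <;> linarith
  refine mem_MSpecK_of_glue hk hpk hpk (by rw [hpx]; ring) (hle _ ?_)
  exact glue_mem (P := fun n => 1 ≤ n ∧ n ≤ k) ⟨hk, le_rfl⟩ hpk hpk

/-- For every integer `k ≥ 2` with `k ≠ 3`, the Markov spectrum of continued
fractions with partial quotients bounded by `k` is an initial segment of the
classical Markov spectrum: `M(k) = M ∩ (-∞, √(k² + 4k)]`. -/
theorem markov_initial_segment (k : ℕ) (hk : 2 ≤ k) (hk3 : k ≠ 3) :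
    MSpecK k = MSpec ∩ Set.Iic (Real.sqrt ((k : ℝ) ^ 2 + 4 * k)) := by
  have hκ2 : (2 : ℝ) ≤ k := by exact_mod_cast hk
  have hκ : (1 : ℝ) ≤ k := by linarith
  have hsq : Real.sqrt ((k : ℝ) ^ 2 + 4 * k) ^ 2 = (k : ℝ) ^ 2 + 4 * k :=
    Real.sq_sqrt (by positivity)
  set S := Real.sqrt ((k : ℝ) ^ 2 + 4 * k)
  have hS0 : 0 ≤ S := Real.sqrt_nonneg _
  have hkS : (k : ℝ) ≤ S := Real.le_sqrt_of_sq_le (by linarith)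
  have hSk : S < k + 2 := lt_of_pow_lt_pow_left₀ 2 (by linarith) (by rw [hsq]; linarith)
  obtain ⟨x, hx⟩ : ∃ x, x = (S - k) / 2 := ⟨_, rfl⟩
  have hSx : S = k + 2 * x := by linarith
  have hx0 : 0 ≤ x := by linarith
  have hxφ : stepMap k x = x := by
    rw [stepMap_fixed_iff hκ hx0, hx]
    linarith
  have hle : ∀ θ : ℤ → ℕ, (∀ i, 1 ≤ θ i ∧ θ i ≤ k) → ∀ i, lamCF θ i ≤ k + 2 * x := by
    intro θ hθ i
    have h1 := cfVal_le_of_le (by omega) hx0 (by linarith) hxφ fun n : ℕ => hθ (i + 1 + n)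
    have h2 := cfVal_le_of_le (by omega) hx0 (by linarith) hxφ fun n : ℕ => hθ (i - 1 - n)
    have h3 : (θ i : ℝ) ≤ k := by exact_mod_cast (hθ i).2
    unfold lamCF
    linarith
  ext t
  constructor
  · rintro ⟨θ, hθ, rfl⟩
    refine ⟨⟨θ, fun i => (hθ i).1, ⟨k + 2 * x, Set.forall_mem_range.2 (hle θ hθ)⟩, rfl⟩, ?_⟩
    rw [Set.mem_Iic, hSx]
    exact ciSup_le (hle θ hθ)
  · rintro ⟨⟨θ, hθ, hb, rfl⟩, ht⟩
    rw [Set.mem_Iic] at ht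
    have hi : ∀ i, lamCF θ i ≤ ⨆ i, lamCF θ i := le_ciSup hb
    by_cases hall : ∀ i, θ i ≤ k
    · exact ⟨θ, fun i => ⟨hθ i, hall i⟩, rfl⟩
    have hθk : ∀ i, θ i ≤ k + 1 := by
      intro i
      have h1 := cfVal_nonneg fun n : ℕ => hθ (i + 1 + n)
      have h2 := cfVal_nonneg fun n : ℕ => hθ (i - 1 - n)
      have h3 : (θ i : ℝ) ≤ ⨆ i, lamCF θ i := by
        refine le_trans ?_ (hi i)
        unfold lamCF
        linarith
      have h4 : (θ i : ℝ) < (k + 2 : ℕ) := by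
        push_cast
        linarith
      have h5 : θ i < k + 2 := by exact_mod_cast h4
      omega
    push Not at hall
    obtain ⟨i, hki⟩ := hall
    have hlow : ∀ c : ℕ → ℕ, (∀ n, 1 ≤ c n) → c 0 ≤ k + 1 → 1 / ((k : ℝ) + 2) ≤ cfVal c := by
      intro c hc hc0
      have h1 : (c 0 : ℝ) ≤ k + 1 := by exact_mod_cast hc0
      exact (one_div_le_one_div_of_le (by positivity) (by linarith)).trans (inv_le_cfVal hc)
    have hT : (k : ℝ) + 1 + 2 / (k + 2) ≤ ⨆ i, lamCF θ i := by
      have h1 := hlow _ (fun n : ℕ => hθ (i + 1 + n)) (hθk _)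
      have h2 := hlow _ (fun n : ℕ => hθ (i - 1 - n)) (hθk _)
      have h3 : (k : ℝ) + 1 ≤ θ i := by exact_mod_cast hki
      have h4 : (2 : ℝ) / (k + 2) = 1 / (k + 2) + 1 / (k + 2) := by ring
      refine le_trans ?_ (hi i)
      unfold lamCF
      linarith
    rcases Nat.lt_or_ge k 4 with hk4 | hk4
    · obtain rfl : k = 2 := by omega
      norm_num at hT hsq
      nlinarith
    · rcases ht.lt_or_eq with hlt | heq
      · exact mem_MSpecK_of_lt hk4 hx0 hxφ hT (hlt.trans_eq hSx)
      · rw [heq, hSx]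
        exact mem_MSpecK_sqrt (by omega) hx0 hxφ hle
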